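/- arXiv:2406.17486 — 3 statements merged into one kernel-verified Lean document; each statement's English description precedes it below -/
import Mathlib

section
/- For every K ∈ ℕ, every m ∈ ℕ∪{0}, every constant 0 < c < 1/2 and every ε > 0 there exists D₀ such that the following holds. Let G ∈ H(K) be a finite graph with δ(G) ≥ D₀, let x ∈ V(G), write d := d(x), let p := 1/2 − c·√(log d/d), let A₀ be a p-random subset of V(G), and let ℓ be an integer with m ≤ ℓ ≤ d/2 + m. Set X₀ := N(x) ∩ A₀ and X₁ := N(x) ∩ (A₁(m) \ A₀), where (A_i(m)) is the m-shifted bootstrap process started from A₀, and let ℰ denote the event (x ∉ A₀) and (|X₀| ≥ d/2 + m − ℓ). Then the conditional variance satisfies Var[ |X₁| | ℰ ] ≤ ε·( E[ |X₁| | ℰ ] )². -/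
open SimpleGraph Filter

namespace MBP

/-- Degree of a vertex, via the cardinality of its neighbourhood. -/
noncomputable def deg {V : Type} (G : SimpleGraph V) (x : V) : ℕ :=
  (G.neighborSet x).ncard

/-- Minimum degree. -/
noncomputable def minDeg {V : Type} (G : SimpleGraph V) : ℕ :=
  sInf (Set.range (deg G))

/-- Maximum degree. -/
noncomputable def maxDeg {V : Type} (G : SimpleGraph V) : ℕ :=
  sSup (Set.range (deg G))

/-- Ball of radius `ℓ` around `x`. -/
def ball {V : Type} (G : SimpleGraph V) (x : V) (ℓ : ℕ) : Set V :=
  {y | G.edist x y ≤ ℓ}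

/-- Sphere of radius `ℓ` around `x` (for `ℓ ≥ 1` this is `B(x,ℓ) \ B(x,ℓ-1)`). -/
def sphere {V : Type} (G : SimpleGraph V) (x : V) (ℓ : ℕ) : Set V :=
  {y | G.edist x y = ℓ}

/-- (P1) locally K-almost regular. -/
def P1 (K : ℕ) {V : Type} (G : SimpleGraph V) : Prop :=
  ∀ (x : V) (ℓ : ℕ), 1 ≤ ℓ → ∀ y ∈ sphere G x ℓ,
    |(deg G x : ℤ) - (deg G y : ℤ)| ≤ (K : ℤ) * ℓ

/-- (P2) K-bounded backwards expansion. -/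
def P2 (K : ℕ) {V : Type} (G : SimpleGraph V) : Prop :=
  ∀ (x : V) (ℓ : ℕ), 1 ≤ ℓ → ∀ y ∈ sphere G x ℓ,
    (G.neighborSet y ∩ ball G x ℓ).ncard ≤ K * ℓ

/-- `D` witnesses property (P3) (typical local structure and K-separation) at vertex `x`. -/
def P3At (K : ℕ) {V : Type} (G : SimpleGraph V) (x : V) (D : Set V) : Prop :=
  x ∉ D ∧ ∀ (ℓ : ℕ), 1 ≤ ℓ →
    ((D ∩ sphere G x ℓ).ncard ≤ K ^ (ℓ - 1) * (deg G x) ^ (ℓ - 1)) ∧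
    (∀ y ∈ sphere G x ℓ \ D, (D ∩ G.neighborSet y).ncard ≤ K * ℓ) ∧
    (∀ y ∈ sphere G x ℓ \ D, ∀ z ∈ sphere G x ℓ \ D, y ≠ z →
      (G.neighborSet y ∩ G.neighborSet z ∩ (sphere G x (ℓ + 1) \ D)).ncard ≤ 1) ∧
    (∀ y ∈ sphere G x ℓ \ D,
      (ball G y (2 * ℓ - 1) ∩ (sphere G x ℓ \ D)).ncard ≤ ℓ * K ^ (ℓ - 1) * (deg G x) ^ (ℓ - 1))

/-- (P3) typical local structure and K-separation. -/
def P3 (K : ℕ) {V : Type} (G : SimpleGraph V) : Prop :=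
  ∀ x : V, ∃ D : Set V, P3At K G x D

/-- (P5) exponential order. -/
def P5 (K : ℕ) {V : Type} (G : SimpleGraph V) : Prop :=
  (Nat.card V : ℝ) ≤ Real.exp (K * minDeg G)

/-- (P4) K-projection, relative to a membership predicate `mem` for the projected subgraphs. -/
def P4With (K : ℕ) {V : Type} (G : SimpleGraph V) (mem : G.Subgraph → Prop) : Prop :=
  ∀ (x : V) (ℓ : ℕ), 1 ≤ ℓ → ∀ y ∈ sphere G x ℓ,
    ∃ H : G.Subgraph, y ∈ H.verts ∧ mem H ∧
      H.verts ∩ ball G x (ℓ - 1) = ∅ ∧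
      ∀ w : H.verts, |(deg H.coe w : ℤ) - (deg G (w : V) : ℤ)| ≤ (K : ℤ) * ℓ

/-- Membership in the class H(K) with recursion fuel `n`. -/
def HAux (K : ℕ) : ℕ → (V : Type) → SimpleGraph V → Prop
  | 0, V, _ => Nat.card V = 1
  | n + 1, V, G =>
      Nat.card V = 1 ∨
        (P1 K G ∧ P2 K G ∧ P3 K G ∧ P4With K G (fun H => HAux K n H.verts H.coe) ∧ P5 K G)

/-- The class `H(K)` of geometric graphs: least class containing the one-vertex graph and
closed under properties (P1)–(P5), where the projections of (P4) again lie in the class. -/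
def InH (K : ℕ) {V : Type} (G : SimpleGraph V) : Prop :=
  ∃ n, HAux K n V G

/-- One round of majority bootstrap percolation: a vertex `v` becomes infected if at least
`d(v)/2` of its neighbours are infected. -/
def bootStep {V : Type} (G : SimpleGraph V) (A : Set V) : Set V :=
  A ∪ {v | (deg G v : ℝ) / 2 ≤ ((G.neighborSet v ∩ A).ncard : ℝ)}

/-- The majority bootstrap percolation process. -/
def bootIter {V : Type} (G : SimpleGraph V) (A0 : Set V) : ℕ → Set V
  | 0 => A0
  | n + 1 => bootStep G (bootIter G A0 n)

/-- `A0` percolates if eventually every vertex is infected. -/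
def Percolates {V : Type} (G : SimpleGraph V) (A0 : Set V) : Prop :=
  (⋃ i, bootIter G A0 i) = Set.univ

/-- Weight of a subset `A` under the `p`-random measure. -/
noncomputable def weight {V : Type} (p : ℝ) (A : Set V) : ℝ :=
  p ^ A.ncard * (1 - p) ^ (Aᶜ).ncard

/-- Probability that a `p`-random subset of `V` satisfies the event `E`. -/
noncomputable def prob {V : Type} (p : ℝ) (E : Set V → Prop) : ℝ :=
  ∑ᶠ A ∈ {A : Set V | E A}, weight p A

/-- Probability that a `p`-random initial set percolates. -/
noncomputable def Phi {V : Type} (p : ℝ) (G : SimpleGraph V) : ℝ :=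
  prob p (fun A0 => Percolates G A0)

/-- One round of the `m`-shifted bootstrap process (threshold `d(v)/2 + m`). -/
def bootStepM {V : Type} (G : SimpleGraph V) (m : ℕ) (A : Set V) : Set V :=
  A ∪ {v | (deg G v : ℝ) / 2 + m ≤ ((G.neighborSet v ∩ A).ncard : ℝ)}

/-- The `m`-shifted bootstrap process. -/
def bootIterM {V : Type} (G : SimpleGraph V) (m : ℕ) (A0 : Set V) : ℕ → Set V
  | 0 => A0
  | n + 1 => bootStepM G m (bootIterM G m A0 n)

/-- `σ(x) = √(log d(x) / d(x))`. -/
noncomputable def sigma' {V : Type} (G : SimpleGraph V) (x : V) : ℝ :=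
  Real.sqrt (Real.log (deg G x) / (deg G x))

/-- `γ(x) = √(d(x) / √(log d(x)))`. -/
noncomputable def gamma' {V : Type} (G : SimpleGraph V) (x : V) : ℝ :=
  Real.sqrt ((deg G x : ℝ) / Real.sqrt (Real.log (deg G x)))

/-- The `Boot₂(γ)` process: in the step from round `ℓ` to round `ℓ+1`, a vertex `v` becomes
infected if at least `d(v)/2 - max(0, 2-ℓ)·γ(v)` of its neighbours are infected. -/
noncomputable def hatIter {V : Type} (G : SimpleGraph V) (A0 : Set V) : ℕ → Set V
  | 0 => A0
  | ℓ + 1 =>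
      hatIter G A0 ℓ ∪
        {v | (deg G v : ℝ) / 2 - ((2 - ℓ : ℕ) : ℝ) * gamma' G v
              ≤ ((G.neighborSet v ∩ hatIter G A0 ℓ).ncard : ℝ)}

/-- Expectation of `f` restricted to the event `E`, under the `p`-random measure. -/
noncomputable def expOn {V : Type} (p : ℝ) (E : Set V → Prop) (f : Set V → ℝ) : ℝ :=
  ∑ᶠ A ∈ {A : Set V | E A}, weight p A * f A

/-- Conditional expectation of `f` given the event `E`. -/
noncomputable def condExp {V : Type} (p : ℝ) (E : Set V → Prop) (f : Set V → ℝ) : ℝ :=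
  expOn p E f / prob p E

/-- Conditional variance of `f` given the event `E`. -/
noncomputable def condVar {V : Type} (p : ℝ) (E : Set V → Prop) (f : Set V → ℝ) : ℝ :=
  condExp p E (fun A => (f A - condExp p E f) ^ 2)

/-- The number of edges between `U` and `W` (ordered pairs `(u,w)` with `u ∈ U`, `w ∈ W`
adjacent; for disjoint sets this is the number of edges with one endpoint in each). -/
noncomputable def eBetween {V : Type} (G : SimpleGraph V) (U W : Set V) : ℕ :=
  {e : V × V | e.1 ∈ U ∧ e.2 ∈ W ∧ G.Adj e.1 e.2}.ncard

/-- Upper tail `Pr[Bin(d,p) ≥ t]` of the binomial distribution. -/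
noncomputable def binTail (d : ℕ) (p : ℝ) (t : ℝ) : ℝ :=
  ∑ k ∈ Finset.range (d + 1),
    if t ≤ (k : ℝ) then (d.choose k : ℝ) * p ^ k * (1 - p) ^ (d - k) else 0


section FiniteProb

set_option linter.unusedSectionVars false

variable {V : Type} [DecidableEq V]

/-- Expectation of `f` over a `p`-random subset of `U`. -/
noncomputable def EU (p : ℝ) (U : Finset V) (f : Finset V → ℝ) : ℝ :=
  ∑ B ∈ U.powerset, p ^ B.card * (1 - p) ^ (U.card - B.card) * f B

lemma EU_one (p : ℝ) (U : Finset V) : EU p U (fun _ => 1) = 1 := by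
  have := Finset.sum_pow_mul_eq_add_pow p (1 - p) U
  simp only [EU, mul_one]
  rw [this]; simp

lemma EU_congr (p : ℝ) (U : Finset V) {f g : Finset V → ℝ} (h : ∀ B ⊆ U, f B = g B) :
    EU p U f = EU p U g := by
  refine Finset.sum_congr rfl fun B hB => ?_
  rw [h B (Finset.mem_powerset.1 hB)]

lemma EU_mono {p : ℝ} (h0 : 0 ≤ p) (h1 : p ≤ 1) (U : Finset V) {f g : Finset V → ℝ}
    (h : ∀ B, f B ≤ g B) : EU p U f ≤ EU p U g := by
  refine Finset.sum_le_sum fun B hB => ?_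
  have : 0 ≤ 1 - p := by linarith
  exact mul_le_mul_of_nonneg_left (h B) (by positivity)

lemma EU_const_mul (p : ℝ) (U : Finset V) (a : ℝ) (f : Finset V → ℝ) :
    EU p U (fun B => a * f B) = a * EU p U f := by
  simp only [EU, Finset.mul_sum]
  exact Finset.sum_congr rfl fun B _ => by ring

lemma EU_mul_const (p : ℝ) (U : Finset V) (a : ℝ) (f : Finset V → ℝ) :
    EU p U (fun B => f B * a) = EU p U f * a := by
  simp only [EU, Finset.sum_mul]
  exact Finset.sum_congr rfl fun B _ => by ring

lemma EU_add (p : ℝ) (U : Finset V) (f g : Finset V → ℝ) :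
    EU p U (fun B => f B + g B) = EU p U f + EU p U g := by
  simp only [EU, ← Finset.sum_add_distrib]
  exact Finset.sum_congr rfl fun B _ => by ring

lemma EU_sum {ι : Type} (p : ℝ) (U : Finset V) (s : Finset ι) (f : ι → Finset V → ℝ) :
    EU p U (fun B => ∑ i ∈ s, f i B) = ∑ i ∈ s, EU p U (f i) := by
  simp only [EU, Finset.mul_sum]
  rw [Finset.sum_comm]

lemma EU_card (p : ℝ) (U : Finset V) (φ : ℕ → ℝ) :
    EU p U (fun B => φ B.card) =
      ∑ j ∈ Finset.range (U.card + 1), (U.card.choose j : ℝ) *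
        (p ^ j * (1 - p) ^ (U.card - j) * φ j) := by
  have := Finset.sum_powerset_apply_card (fun j => p ^ j * (1 - p) ^ (U.card - j) * φ j) (x := U)
  simp only [EU]
  rw [this]
  exact Finset.sum_congr rfl fun j _ => by simp

lemma EU_split (p : ℝ) (U W : Finset V) (h : Disjoint U W) (f : Finset V → ℝ) :
    EU p (U ∪ W) f = EU p U (fun B => EU p W (fun C => f (B ∪ C))) := by
  simp only [EU, Finset.mul_sum]
  rw [← Finset.sum_product']
  symm
  refine Finset.sum_nbij' (fun x => x.1 ∪ x.2) (fun A => (A ∩ U, A ∩ W)) ?_ ?_ ?_ ?_ ?_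
  · intro x hx
    simp only [Finset.mem_product, Finset.mem_powerset] at hx ⊢
    exact Finset.union_subset_union hx.1 hx.2
  · intro A hA
    simp
  · rintro ⟨B, C⟩ hx
    simp only [Finset.mem_product, Finset.mem_powerset] at hx
    have h' := Finset.disjoint_left.1 h
    ext a
    · simp only [Finset.mem_inter, Finset.mem_union]
      have := @hx.1 a
      have := @hx.2 a
      have := @h' a
      tauto
    · simp only [Finset.mem_inter, Finset.mem_union]
      have := @hx.1 a
      have := @hx.2 a
      have := @h' a
      tauto
  · intro A hA
    simp only [Finset.mem_powerset] at hA
    rw [← Finset.inter_union_distrib_left]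
    exact Finset.inter_eq_left.2 hA
  · rintro ⟨B, C⟩ hx
    simp only [Finset.mem_product, Finset.mem_powerset] at hx
    have hd : Disjoint B C := Finset.disjoint_of_subset_left hx.1
      (Finset.disjoint_of_subset_right hx.2 h)
    have h1 := Finset.card_le_card hx.1
    have h2 := Finset.card_le_card hx.2
    simp only
    rw [Finset.card_union_of_disjoint hd, Finset.card_union_of_disjoint h]
    have : U.card + W.card - (B.card + C.card) = (U.card - B.card) + (W.card - C.card) := by omega
    rw [this, pow_add, pow_add]
    ring

variable [Fintype V]

/-- Expectation over a `p`-random subset of the whole vertex set. -/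
noncomputable def EE (p : ℝ) (f : Finset V → ℝ) : ℝ := EU p Finset.univ f

lemma EE_local (p : ℝ) (S : Finset V) (f : Finset V → ℝ) (hf : ∀ A, f A = f (A ∩ S)) :
    EE p f = EU p S f := by
  have : (Finset.univ : Finset V) = S ∪ Sᶜ := by simp
  rw [EE, this, EU_split p S Sᶜ disjoint_compl_right]
  refine EU_congr p S fun B hB => ?_
  have : EU p Sᶜ (fun C => f (B ∪ C)) = EU p Sᶜ (fun _ => f B * 1) := by
    refine EU_congr _ _ fun C hC => ?_
    rw [hf, hf B, mul_one]
    congr 1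
    ext a
    have := @hC a
    simp only [Finset.mem_inter, Finset.mem_union, Finset.mem_compl] at this ⊢
    tauto
  rw [this, EU_const_mul, EU_one, mul_one]

lemma EE_indep (p : ℝ) (S T : Finset V) (hST : Disjoint S T) (f g : Finset V → ℝ)
    (hf : ∀ A, f A = f (A ∩ S)) (hg : ∀ A, g A = g (A ∩ T)) :
    EE p (fun A => f A * g A) = EE p f * EE p g := by
  rw [EE_local p S f hf, EE_local p T g hg]
  rw [EE_local p (S ∪ T) _ (fun A => ?_), EU_split p S T hST]
  · rw [← EU_mul_const]
    refine EU_congr _ _ fun B hB => ?_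
    rw [← EU_const_mul]
    refine EU_congr _ _ fun C hC => ?_
    have h' := Finset.disjoint_left.1 hST
    rw [hf, hf B, hg, hg C]
    congr 2
    · ext a
      have := @hB a
      have := @hC a
      have := @h' a
      simp only [Finset.mem_inter, Finset.mem_union]
      tauto
    · ext a
      have := @hB a
      have := @hC a
      have := @h' a
      simp only [Finset.mem_inter, Finset.mem_union]
      tauto
  · rw [hf, hg, hf (A ∩ (S ∪ T)), hg (A ∩ (S ∪ T))]
    congr 2
    · ext a
      simp only [Finset.mem_inter, Finset.mem_union]
      tauto
    · ext a
      simp only [Finset.mem_inter, Finset.mem_union]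
      tauto

/-- Upper tail of the binomial distribution with natural threshold. -/
noncomputable def bt (p : ℝ) (n t : ℕ) : ℝ :=
  ∑ j ∈ Finset.range (n + 1), if t ≤ j then (n.choose j : ℝ) * p ^ j * (1 - p) ^ (n - j) else 0

open Classical in
lemma EE_tail (p : ℝ) (U : Finset V) (t : ℕ) :
    EE p (fun A => if t ≤ (U ∩ A).card then (1 : ℝ) else 0) = bt p U.card t := by
  rw [EE_local p U]
  · have hc := EU_card p U (fun j : ℕ => if t ≤ j then (1 : ℝ) else 0)
    rw [EU_congr p U (g := fun B => if t ≤ B.card then (1 : ℝ) else 0), hc]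
    · refine Finset.sum_congr rfl fun j _ => ?_
      split_ifs <;> ring
    · intro B hB
      simp [Finset.inter_eq_right.2 hB]
  · intro A
    simp [Finset.inter_comm]

lemma EE_notMem (p : ℝ) (y : V) :
    EE p (fun A => if y ∉ A then (1 : ℝ) else 0) = 1 - p := by
  rw [EE_local p {y}]
  · have h : ({y} : Finset V).powerset = {∅, {y}} := by
      ext B; simp [Finset.subset_singleton_iff]
    rw [EU, h, Finset.sum_pair (by simp)]
    simp
  · intro A
    by_cases h : y ∈ A <;> simp [h]

lemma EE_mono {p : ℝ} (h0 : 0 ≤ p) (h1 : p ≤ 1) {f g : Finset V → ℝ}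
    (h : ∀ B, f B ≤ g B) : EE p f ≤ EE p g := EU_mono h0 h1 _ h

lemma expOn_eq (p : ℝ) (E : Set V → Prop) [∀ A : Finset V, Decidable (E (A : Set V))]
    (f : Set V → ℝ) :
    expOn p E f = EE p (fun A : Finset V => if E (A : Set V) then f (A : Set V) else 0) := by
  classical
  rw [expOn, EE, EU]
  have h1 : ∀ A : Set V, (∑ᶠ (_ : A ∈ {A | E A}), weight p A * f A) =
      if E A then weight p A * f A else 0 := by
    intro A
    by_cases h : E A
    · simp [h]
    · simp [h]
  rw [finsum_congr h1, finsum_eq_sum_of_fintype, ← (Fintype.finsetEquivSet (α := V)).sum_comp]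
  simp only [Finset.powerset_univ]
  refine Finset.sum_congr rfl fun A _ => ?_
  have hA : Fintype.finsetEquivSet A = (A : Set V) := rfl
  by_cases hE : E (A : Set V)
  · rw [if_pos (show E (Fintype.finsetEquivSet A) from hE), if_pos hE, hA, weight,
      ← Finset.coe_compl, Set.ncard_coe_finset, Set.ncard_coe_finset,
      Finset.card_compl, Finset.card_univ]
  · rw [if_neg (show ¬ E (Fintype.finsetEquivSet A) from hE), if_neg hE, mul_zero]

lemma prob_eq (p : ℝ) (E : Set V → Prop) [∀ A : Finset V, Decidable (E (A : Set V))] :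
    prob p E = EE p (fun A : Finset V => if E (A : Set V) then 1 else 0) := by
  rw [← expOn_eq p E (fun _ => 1)]
  simp [prob, expOn]

/-- Transfer from the unconditional second moment to the conditional variance. -/
lemma cond_transfer {p : ℝ} (h0 : 0 ≤ p) (h1 : p ≤ 1) (E : Set V → Prop) (f : Set V → ℝ)
    (μ κ P ε : ℝ) (hμ : EE p (fun A : Finset V => f (A : Set V)) = μ) (hμ0 : 0 ≤ μ)
    (h2 : EE p (fun A : Finset V => f (A : Set V) ^ 2) ≤ (1 + κ) * μ ^ 2)
    (hP0 : 0 < P) (hP : P ≤ prob p E) (hκ0 : 0 ≤ κ) (hκ : κ / P ≤ 1 / 4) (hε : κ / P ≤ ε / 4) :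
    condVar p E f ≤ ε * (condExp p E f) ^ 2 := by
  classical
  set Q := prob p E with hQ
  have hQ0 : 0 < Q := lt_of_lt_of_le hP0 hP
  set e := condExp p E f with he
  have hQE : EE p (fun A : Finset V => if E (A : Set V) then 1 else 0) = Q := (prob_eq p E).symm
  have hX1 : EE p (fun A : Finset V => if E (A : Set V) then f (A : Set V) else 0) = e * Q := by
    rw [← expOn_eq, he, condExp, ← hQ, div_mul_cancel₀ _ hQ0.ne']
  -- quadratic expansion
  have quad : ∀ a : ℝ, EE p (fun A : Finset V => if E (A : Set V) then (f (A : Set V) - a) ^ 2 else 0) =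
      EE p (fun A : Finset V => if E (A : Set V) then f (A : Set V) ^ 2 else 0) - 2 * a * (e * Q)
        + a ^ 2 * Q := by
    intro a
    rw [← hX1]
    conv_rhs => rw [← hQE]
    simp only [EE]
    rw [sub_eq_add_neg, ← neg_mul, ← EU_const_mul, ← EU_const_mul, ← EU_add, ← EU_add]
    refine EU_congr _ _ fun B _ => ?_
    split_ifs <;> ring
  have hvar : condVar p E f * Q =
      EE p (fun A : Finset V => if E (A : Set V) then (f (A : Set V) - e) ^ 2 else 0) := by
    rw [condVar, condExp, expOn_eq, ← hQ, div_mul_cancel₀ _ hQ0.ne']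
  have hall : EE p (fun A : Finset V => (f (A : Set V) - μ) ^ 2) ≤ κ * μ ^ 2 := by
    have : EE p (fun A : Finset V => (f (A : Set V) - μ) ^ 2) =
        EE p (fun A : Finset V => f (A : Set V) ^ 2) - 2 * μ * μ + μ ^ 2 * 1 := by
      nth_rw 3 [← hμ]
      rw [← EU_one p (Finset.univ : Finset V)]
      simp only [EE]
      rw [sub_eq_add_neg, ← neg_mul, ← EU_const_mul, ← EU_const_mul, ← EU_add, ← EU_add]
      refine EU_congr _ _ fun B _ => ?_
      ring
    rw [this]; linarith
  have hle : EE p (fun A : Finset V => if E (A : Set V) then (f (A : Set V) - μ) ^ 2 else 0) ≤ κ * μ ^ 2 := by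
    refine le_trans (EE_mono h0 h1 fun A => ?_) hall
    split_ifs
    · exact le_rfl
    · positivity
  have key : (condVar p E f + (e - μ) ^ 2) * Q ≤ κ * μ ^ 2 := by
    rw [add_mul, hvar, quad e]
    rw [quad μ] at hle
    linarith
  have hv0 : 0 ≤ condVar p E f := by
    have : 0 ≤ condVar p E f * Q := by
      rw [hvar]
      have : EE p (fun _ : Finset V => (0 : ℝ)) = 0 := by simp [EE, EU]
      refine this.symm.le.trans (EE_mono h0 h1 fun A => ?_)
      split_ifs
      · positivity
      · exact le_rfl
    exact nonneg_of_mul_nonneg_left this hQ0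
  have key2 : condVar p E f + (e - μ) ^ 2 ≤ (κ / P) * μ ^ 2 := by
    have : (condVar p E f + (e - μ) ^ 2) * P ≤ κ * μ ^ 2 :=
      le_trans (mul_le_mul_of_nonneg_left hP (by positivity)) key
    rw [div_mul_eq_mul_div, le_div_iff₀ hP0]
    exact this
  have hμ2 : 0 ≤ μ ^ 2 := by positivity
  have a1 : (e - μ) ^ 2 ≤ (μ / 2) ^ 2 := by nlinarith
  have a2 : |e - μ| ≤ μ / 2 := abs_le_of_sq_le_sq a1 (by positivity)
  have a3 : μ / 2 ≤ e := by have := (abs_le.1 a2).1; linarith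
  have a4 : (μ / 2) ^ 2 ≤ e ^ 2 := by gcongr
  have hε0 : 0 ≤ ε := by
    have : 0 ≤ κ / P := by positivity
    linarith
  have a5 : (κ / P) * μ ^ 2 ≤ ε / 4 * μ ^ 2 := by gcongr
  nlinarith [sq_nonneg (e - μ)]

end FiniteProb

section Binomial

/-- Binomial point probability. -/
noncomputable def bp (p : ℝ) (n j : ℕ) : ℝ := (n.choose j : ℝ) * p ^ j * (1 - p) ^ (n - j)

lemma bp_nonneg {p : ℝ} (h0 : 0 ≤ p) (h1 : p ≤ 1) (n j : ℕ) : 0 ≤ bp p n j := by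
  have : 0 ≤ 1 - p := by linarith
  unfold bp; positivity

lemma bp_ratio (p : ℝ) (n j : ℕ) (hj : j < n) :
    bp p n (j + 1) * ((j + 1 : ℝ) * (1 - p)) = bp p n j * ((n - j : ℝ) * p) := by
  have h := Nat.choose_succ_right_eq n j
  have h' : (n.choose (j + 1) : ℝ) * (j + 1) = n.choose j * (n - j) := by
    have : ((n - j : ℕ) : ℝ) = (n : ℝ) - j := Nat.cast_sub hj.le
    rw [← this]; exact_mod_cast h
  have e : n - j = (n - (j + 1)) + 1 := by omega
  unfold bp
  rw [e, pow_succ, pow_succ]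
  linear_combination (p ^ j * p * (1 - p) ^ (n - (j + 1)) * (1 - p)) * h'

lemma bp_step {a : ℝ} (ha0 : 0 ≤ a) (ha : a ≤ 1 / 4) (n L j : ℕ) (hL : 2 * L + 2 ≤ n)
    (hj : 2 * j ≤ n + 2 * L) (r : ℝ) (hr : 4 * a + (4 * L + 2) / n ≤ r) (hr1 : r ≤ 1) :
    (1 - r) * bp (1 / 2 - a) n j ≤ bp (1 / 2 - a) n (j + 1) := by
  have hjn : j < n := by omega
  have hn : (0 : ℝ) < n := by exact_mod_cast (by omega : 0 < n)
  have h := bp_ratio (1 / 2 - a) n j hjn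
  have hb := bp_nonneg (p := 1 / 2 - a) (by linarith) (by linarith) n j
  have hjR : 2 * (j : ℝ) ≤ n + 2 * L := by exact_mod_cast hj
  have hLR : 2 * (L : ℝ) + 2 ≤ n := by exact_mod_cast hL
  set v : ℝ := (4 * L + 2) / n with hv
  have hvn : v * n = 4 * L + 2 := by rw [hv]; field_simp
  have hL0 : (0 : ℝ) ≤ L := by positivity
  have hv0 : 0 ≤ v := by positivity
  have hv1 : 0 ≤ 1 - v := by linarith
  have s1 : (1 - v) * (j + 1) ≤ n - j := by
    have : (1 - v) * ((j : ℝ) + 1) ≤ (1 - v) * (n / 2 + L + 1) := by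
      apply mul_le_mul_of_nonneg_left _ hv1; linarith
    nlinarith
  have s2 : (1 - 4 * a) * (1 / 2 + a) ≤ 1 / 2 - a := by nlinarith
  have s3 : ((1 - v) * (j + 1)) * ((1 - 4 * a) * (1 / 2 + a)) ≤ (n - j) * (1 / 2 - a) := by
    apply mul_le_mul s1 s2
    · apply mul_nonneg <;> linarith
    · linarith [(by positivity : (0 : ℝ) ≤ j), (by exact_mod_cast hjn.le : (j : ℝ) ≤ n)]
  have s4 : (1 - r) ≤ (1 - v) * (1 - 4 * a) := by nlinarith
  have s5 : (1 - r) * (((j : ℝ) + 1) * (1 / 2 + a)) ≤ (n - j) * (1 / 2 - a) := by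
    refine le_trans ?_ s3
    have : (0 : ℝ) ≤ ((j : ℝ) + 1) * (1 / 2 + a) := by positivity
    calc _ ≤ ((1 - v) * (1 - 4 * a)) * (((j : ℝ) + 1) * (1 / 2 + a)) :=
          mul_le_mul_of_nonneg_right s4 this
      _ = _ := by ring
  have hpos : (0 : ℝ) < ((j : ℝ) + 1) * (1 / 2 + a) := by positivity
  refine le_of_mul_le_mul_right ?_ hpos
  have e : bp (1 / 2 - a) n (j + 1) * (((j : ℝ) + 1) * (1 / 2 + a)) =
      bp (1 / 2 - a) n j * ((n - j : ℝ) * (1 / 2 - a)) := by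
    rw [← h]; ring
  rw [e]
  calc _ = bp (1 / 2 - a) n j * ((1 - r) * (((j : ℝ) + 1) * (1 / 2 + a))) := by ring
    _ ≤ _ := mul_le_mul_of_nonneg_left s5 hb

lemma bp_half {a : ℝ} (ha0 : 0 ≤ a) (ha : a ≤ 1 / 4) (n L N : ℕ) (hL : 2 * L + 2 ≤ n)
    (hN : (N : ℝ) * (4 * a + (4 * L + 2) / n) ≤ 1 / 2) (j i : ℕ) (hi : i ≤ N)
    (hj : 2 * (j + i) ≤ n + 2 * L) :
    bp (1 / 2 - a) n j ≤ 2 * bp (1 / 2 - a) n (j + i) := by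
  have hb := bp_nonneg (p := 1 / 2 - a) (by linarith) (by linarith) n
  rcases Nat.eq_zero_or_pos i with rfl | hi0
  · have := hb j; simp; linarith
  set r : ℝ := 4 * a + (4 * L + 2) / n with hr
  have hN1 : (1 : ℝ) ≤ N := by exact_mod_cast (by omega : 1 ≤ N)
  have hr0 : 0 ≤ r := by positivity
  have hr1 : r ≤ 1 / 2 := by nlinarith
  have it : ∀ i : ℕ, 2 * (j + i) ≤ n + 2 * L →
      (1 - r) ^ i * bp (1 / 2 - a) n j ≤ bp (1 / 2 - a) n (j + i) := by
    intro i
    induction i with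
    | zero => intro _; simp
    | succ i ih =>
      intro h
      have h1 := ih (by omega)
      have h2 := bp_step ha0 ha n L (j + i) hL (by omega) r hr.ge (by linarith)
      rw [← add_assoc]
      refine le_trans ?_ h2
      rw [pow_succ']
      rw [mul_assoc]
      exact mul_le_mul_of_nonneg_left h1 (by linarith)
  have hB : (1 : ℝ) / 2 ≤ (1 - r) ^ i := by
    have := one_add_mul_le_pow (a := -r) (by linarith) i
    have hiN : (i : ℝ) ≤ N := by exact_mod_cast hi
    have : (i : ℝ) * r ≤ N * r := mul_le_mul_of_nonneg_right hiN hr0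
    rw [sub_eq_add_neg]
    nlinarith
  have := it i hj
  have := mul_le_mul_of_nonneg_right hB (hb j)
  linarith

lemma bt_eq (p : ℝ) (n t : ℕ) : bt p n t = ∑ j ∈ Finset.Ico t (n + 1), bp p n j := by
  unfold bt
  rw [← Finset.sum_filter]
  apply Finset.sum_congr
  · ext j; simp; tauto
  · intros; rfl

lemma bt_ge_sum {p : ℝ} (h0 : 0 ≤ p) (h1 : p ≤ 1) (n t M : ℕ) (h : t + M ≤ n + 1) :
    ∑ i ∈ Finset.range M, bp p n (t + i) ≤ bt p n t := by
  rw [bt_eq]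
  have : ∑ i ∈ Finset.range M, bp p n (t + i) = ∑ j ∈ Finset.Ico t (t + M), bp p n j := by
    rw [Finset.sum_Ico_eq_sum_range]; simp
  rw [this]
  apply Finset.sum_le_sum_of_subset_of_nonneg
  · intro j; simp; omega
  · intros; exact bp_nonneg h0 h1 _ _

lemma bt_nonneg {p : ℝ} (h0 : 0 ≤ p) (h1 : p ≤ 1) (n t : ℕ) : 0 ≤ bt p n t := by
  rw [bt_eq]; exact Finset.sum_nonneg fun j _ => bp_nonneg h0 h1 _ _

lemma bt_shift {a : ℝ} (ha0 : 0 ≤ a) (ha : a ≤ 1 / 4) (n m N k : ℕ)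
    (hL : 2 * (N + m + 1) + 2 ≤ n)
    (hN : (N : ℝ) * (4 * a + (4 * ((N + m + 1 : ℕ) : ℝ) + 2) / n) ≤ 1 / 2) (hk : 2 * k ≤ N)
    (hN0 : 0 < N) :
    bt (1 / 2 - a) n ((n + 1) / 2 + m - k) ≤
      (1 + 4 * k / N) * bt (1 / 2 - a) n ((n + 1) / 2 + m) := by
  set t := (n + 1) / 2 + m with ht
  have hb := bp_nonneg (p := 1 / 2 - a) (by linarith) (by linarith) n
  have hT := bt_nonneg (p := 1 / 2 - a) (by linarith) (by linarith) n t
  have hNR : (0 : ℝ) < N := by exact_mod_cast hN0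
  have hkR : 2 * (k : ℝ) ≤ N := by exact_mod_cast hk
  have one : ∀ j ∈ Finset.Ico (t - k) t, bp (1 / 2 - a) n j ≤
      (4 / N) * bt (1 / 2 - a) n t := by
    intro j hj
    rw [Finset.mem_Ico] at hj
    have h1 := bt_ge_sum (p := 1 / 2 - a) (by linarith) (by linarith) n t (N - k) (by omega)
    have h2 : ∑ i ∈ Finset.range (N - k), bp (1 / 2 - a) n j ≤
        ∑ i ∈ Finset.range (N - k), 2 * bp (1 / 2 - a) n (t + i) := by
      refine Finset.sum_le_sum fun i hi => ?_
      rw [Finset.mem_range] at hi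
      have := bp_half ha0 ha n (N + m + 1) N hL hN j (t + i - j) (by omega) (by omega)
      rwa [show j + (t + i - j) = t + i by omega] at this
    rw [← Finset.mul_sum, Finset.sum_const, Finset.card_range, nsmul_eq_mul,
      Nat.cast_sub (by omega)] at h2
    have h3 : (N : ℝ) / 2 * bp (1 / 2 - a) n j ≤ 2 * bt (1 / 2 - a) n t := by
      have : (N : ℝ) / 2 * bp (1 / 2 - a) n j ≤ ((N : ℝ) - k) * bp (1 / 2 - a) n j :=
        mul_le_mul_of_nonneg_right (by linarith) (hb j)
      linarith
    rw [div_mul_eq_mul_div, le_div_iff₀ hNR]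
    linarith
  have hsum := Finset.sum_le_card_nsmul _ _ _ one
  rw [Nat.card_Ico, nsmul_eq_mul] at hsum
  have hsplit : bt (1 / 2 - a) n (t - k) =
      ∑ j ∈ Finset.Ico (t - k) t, bp (1 / 2 - a) n j + bt (1 / 2 - a) n t := by
    rw [bt_eq, bt_eq, Finset.sum_Ico_consecutive] <;> omega
  have hc : ((t - (t - k) : ℕ) : ℝ) ≤ k := by exact_mod_cast (by omega)
  have : ((t - (t - k) : ℕ) : ℝ) * ((4 / N) * bt (1 / 2 - a) n t) ≤
      k * ((4 / N) * bt (1 / 2 - a) n t) := mul_le_mul_of_nonneg_right hc (by positivity)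
  rw [hsplit]
  calc _ ≤ k * ((4 / N) * bt (1 / 2 - a) n t) + bt (1 / 2 - a) n t := by linarith
    _ = _ := by ring

lemma bt_lower {a : ℝ} (ha0 : 0 ≤ a) (ha : a ≤ 1 / 4) (n m N : ℕ)
    (hL : 2 * (N + m + 1) + 2 ≤ n)
    (hN : (N : ℝ) * (4 * a + (4 * ((N + m + 1 : ℕ) : ℝ) + 2) / n) ≤ 1 / 2) (hm : m + 1 ≤ N) :
    N / 4 * bp (1 / 2 - a) n (n / 2) ≤ bt (1 / 2 - a) n ((n + 1) / 2 + m) := by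
  set t := (n + 1) / 2 + m with ht
  have hb := bp_nonneg (p := 1 / 2 - a) (by linarith) (by linarith) n
  have h0 := bp_half ha0 ha n (N + m + 1) N hL hN (n / 2) (t - n / 2) (by omega) (by omega)
  rw [show n / 2 + (t - n / 2) = t by omega] at h0
  have h1 := bt_ge_sum (p := 1 / 2 - a) (by linarith) (by linarith) n t N (by omega)
  have h2 : ∑ i ∈ Finset.range N, bp (1 / 2 - a) n t ≤
      ∑ i ∈ Finset.range N, 2 * bp (1 / 2 - a) n (t + i) := by
    refine Finset.sum_le_sum fun i hi => ?_
    rw [Finset.mem_range] at hi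
    exact bp_half ha0 ha n (N + m + 1) N hL hN t i (by omega) (by omega)
  rw [← Finset.mul_sum, Finset.sum_const, Finset.card_range, nsmul_eq_mul] at h2
  have : (N : ℝ) * bp (1 / 2 - a) n (n / 2) ≤ N * (2 * bp (1 / 2 - a) n t) :=
    mul_le_mul_of_nonneg_left h0 (by positivity)
  linarith

lemma central_sq (h : ℕ) (hh : 0 < h) : 16 ^ h ≤ 4 * h * (Nat.centralBinom h) ^ 2 := by
  induction h, hh using Nat.le_induction with
  | base => simp [Nat.centralBinom, Nat.choose]
  | succ h hh ih =>
    have e := Nat.succ_mul_centralBinom_succ h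
    have hpos : 0 < h := hh
    have key : 16 ^ (h + 1) * (h * (h + 1)) ≤
        (4 * (h + 1) * (Nat.centralBinom (h + 1)) ^ 2) * (h * (h + 1)) := by
      calc 16 ^ (h + 1) * (h * (h + 1)) = 16 ^ h * (16 * (h * (h + 1))) := by ring
        _ ≤ (4 * h * (Nat.centralBinom h) ^ 2) * (16 * (h * (h + 1))) :=
            Nat.mul_le_mul_right _ ih
        _ ≤ (4 * h) * (2 * (2 * h + 1) * Nat.centralBinom h) ^ 2 := by
            have : 16 * (h * (h + 1)) ≤ (2 * (2 * h + 1)) ^ 2 := by nlinarith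
            calc _ = (4 * h * (Nat.centralBinom h) ^ 2) * (16 * (h * (h + 1))) := rfl
              _ ≤ (4 * h * (Nat.centralBinom h) ^ 2) * (2 * (2 * h + 1)) ^ 2 :=
                Nat.mul_le_mul_left _ this
              _ = _ := by ring
        _ = _ := by rw [← e]; ring
    exact Nat.le_of_mul_le_mul_right key (by positivity)

lemma choose_half_sq (n : ℕ) (hn : 0 < n) : 4 ^ n ≤ 4 * (n + 1) * (n.choose (n / 2)) ^ 2 := by
  obtain ⟨h, rfl | rfl⟩ : ∃ h, n = 2 * h ∨ n = 2 * h + 1 := ⟨n / 2, by omega⟩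
  · have := central_sq h (by omega)
    rw [show 2 * h / 2 = h by omega, ← Nat.centralBinom_eq_two_mul_choose, pow_mul]
    norm_num
    refine this.trans (Nat.mul_le_mul_right _ (by omega))
  · have := central_sq (h + 1) (by omega)
    have e : Nat.centralBinom (h + 1) = 2 * (2 * h + 1).choose h := by
      rw [Nat.centralBinom_eq_two_mul_choose, show 2 * (h + 1) = (2 * h + 1) + 1 by ring,
        Nat.choose_succ_succ, Nat.choose_symm_half]
      ring
    rw [show (2 * h + 1) / 2 = h by omega]
    rw [e] at this
    have e2 : (16 : ℕ) ^ (h + 1) = 4 * 4 ^ (2 * h + 1) := by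
      rw [pow_succ, pow_succ, pow_mul]; norm_num; ring
    rw [e2] at this
    nlinarith

lemma bp_central {a : ℝ} (ha0 : 0 ≤ a) (ha : a ≤ 1 / 4) (n : ℕ) (hn : 0 < n) :
    (1 - 4 * a ^ 2) ^ (n / 2) / (4 * Real.sqrt (n + 1)) ≤ bp (1 / 2 - a) n (n / 2) := by
  have hc := choose_half_sq n hn
  have hcR : (4 : ℝ) ^ n ≤ 4 * (n + 1) * (n.choose (n / 2) : ℝ) ^ 2 := by exact_mod_cast hc
  have hs : 0 < Real.sqrt ((n : ℝ) + 1) := Real.sqrt_pos.2 (by positivity)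
  have h1 : (2 : ℝ) ^ n ≤ 2 * Real.sqrt (n + 1) * (n.choose (n / 2) : ℝ) := by
    apply le_of_sq_le_sq _ (by positivity)
    rw [mul_pow, mul_pow, Real.sq_sqrt (by positivity), ← pow_mul, mul_comm n 2, pow_mul]
    norm_num at hcR ⊢
    exact hcR
  set h := n / 2 with hh
  have hq : (1 : ℝ) / 2 ≤ 1 - (1 / 2 - a) := by linarith
  have h4 : (4 : ℝ) ^ h / 2 ≤ 2 ^ n * (1 - (1 / 2 - a)) ^ (n - 2 * h) * 1 := by
    have hd : n - 2 * h = 0 ∨ n - 2 * h = 1 := by omega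
    rcases hd with hd | hd
    · have : n = 2 * h := by omega
      rw [hd, this, pow_mul]; norm_num
    · have : n = 2 * h + 1 := by omega
      rw [hd, this, pow_succ, pow_mul]; norm_num
      have : (0 : ℝ) < 4 ^ h := by positivity
      nlinarith
  have hpq : (0 : ℝ) ≤ ((1 / 2 - a) * (1 - (1 / 2 - a))) ^ h := by
    apply pow_nonneg; apply mul_nonneg <;> linarith
  rw [div_le_iff₀ (by positivity)]
  have e1 : (1 - 4 * a ^ 2) ^ h = 4 ^ h * ((1 / 2 - a) * (1 - (1 / 2 - a))) ^ h := by
    rw [← mul_pow]; congr 1; ring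
  have e2 : bp (1 / 2 - a) n h = (n.choose h : ℝ) * ((1 / 2 - a) * (1 - (1 / 2 - a))) ^ h *
      (1 - (1 / 2 - a)) ^ (n - 2 * h) := by
    unfold bp
    rw [show n - h = h + (n - 2 * h) by omega, pow_add, mul_pow]
    ring
  rw [e1, e2]
  have hqq : (0 : ℝ) ≤ (1 - (1 / 2 - a)) ^ (n - 2 * h) := by apply pow_nonneg; linarith
  set Y := ((1 / 2 - a) * (1 - (1 / 2 - a))) ^ h
  set Z := (1 - (1 / 2 - a)) ^ (n - 2 * h)
  calc (4 : ℝ) ^ h * Y = 2 * (4 ^ h / 2) * Y := by ring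
    _ ≤ 2 * (2 ^ n * Z * 1) * Y := by gcongr
    _ ≤ 2 * ((2 * Real.sqrt (n + 1) * (n.choose h : ℝ)) * Z * 1) * Y := by gcongr
    _ = _ := by ring

end Binomial

section Asymptotics

lemma tendsto_log_div : Tendsto (fun d : ℕ => Real.log d / (d : ℝ)) atTop (nhds 0) := by
  have h := (Real.isLittleO_log_id_atTop).tendsto_div_nhds_zero
  exact h.comp tendsto_natCast_atTop_atTop

lemma tendsto_log_mul_rpow (s : ℝ) (hs : s < 0) :
    Tendsto (fun d : ℕ => Real.log d * Real.exp (s * Real.log d)) atTop (nhds 0) := by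
  have h := (isLittleO_log_rpow_atTop (r := -s) (by linarith)).tendsto_div_nhds_zero
  have h2 := h.comp tendsto_natCast_atTop_atTop
  refine h2.congr' ?_
  filter_upwards [eventually_gt_atTop 0] with d hd
  have hd' : (0 : ℝ) < d := by exact_mod_cast hd
  simp only [Function.comp]
  rw [Real.rpow_def_of_pos hd', div_eq_mul_inv, ← Real.exp_neg]
  congr 2; ring

set_option maxHeartbeats 1000000 in
/-- The deterministic estimate behind `analytic`, for a fixed `d` that is large enough. -/
lemma analytic_core (K m k : ℕ) (c θ : ℝ) (hc0 : 0 < c) (hc : c < 1 / 2) (hθ : 0 < θ) (d n : ℕ)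
    (σ : ℝ) (hσ0 : 0 < σ) (hσd : σ ^ 2 * d = Real.log d) (hlog : 1 ≤ Real.log d)
    (hσ1 : 2 * k + 4 * m + 6 ≤ 1 / (32 * σ)) (hdK : 2 * K + 2 ≤ d)
    (hexp : 2 * c ^ 2 * (1 + K / d) ≤ (2 * c ^ 2 + θ) * (1 - 4 * c ^ 2 * σ ^ 2))
    (hn1 : n ≤ d + K) (hn2 : d ≤ n + K) :
    bt (1 / 2 - c * σ) n ((n + 1) / 2 + m - k) ≤
      (1 + 128 * k * σ) * bt (1 / 2 - c * σ) n ((n + 1) / 2 + m) ∧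
    Real.exp (-(2 * c ^ 2 + θ) * Real.log d) / (1024 * Real.sqrt (Real.log d)) ≤
      bt (1 / 2 - c * σ) n ((n + 1) / 2 + m) := by
  set N : ℕ := ⌊1 / (16 * σ)⌋₊ with hN
  have hkm : (6 : ℝ) ≤ 1 / (32 * σ) := by
    have : (0 : ℝ) ≤ k := by positivity
    have : (0 : ℝ) ≤ m := by positivity
    linarith
  have h16 : 1 / (16 * σ) = 2 * (1 / (32 * σ)) := by field_simp; norm_num
  have hNle : (N : ℝ) ≤ 1 / (16 * σ) := Nat.floor_le (by positivity)
  have hNge : 1 / (32 * σ) ≤ (N : ℝ) := by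
    have := Nat.lt_floor_add_one (1 / (16 * σ))
    rw [← hN] at this
    linarith
  have hNσ : (N : ℝ) * σ ≤ 1 / 16 := by
    rw [le_div_iff₀ (by positivity)] at hNle; linarith
  have hNkm : 2 * k + 4 * m + 6 ≤ N := by
    have : (2 * k + 4 * m + 6 : ℝ) ≤ N := hσ1.trans hNge
    exact_mod_cast this
  have hd0 : (0 : ℝ) < d := by exact_mod_cast (by omega : 0 < d)
  have hdn : d ≤ 2 * n := by omega
  have hdnR : (d : ℝ) ≤ 2 * n := by exact_mod_cast hdn
  have hn0 : (0 : ℝ) < n := by linarith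
  have hNR6 : (6 : ℝ) ≤ N := by linarith
  have hσs : σ ≤ 1 / 96 := by nlinarith
  have hN2 : 256 * (N : ℝ) ^ 2 ≤ d := by
    have h1 : (N * σ) ^ 2 ≤ (1 / 16) ^ 2 := by gcongr
    have h2 : (N : ℝ) ^ 2 * (σ ^ 2 * d) ≤ (1 / 16) ^ 2 * d := by
      calc _ = (N * σ) ^ 2 * d := by ring
        _ ≤ _ := by gcongr
    rw [hσd] at h2
    have : (N : ℝ) ^ 2 * 1 ≤ (N : ℝ) ^ 2 * Real.log d := by gcongr
    linarith
  have hN2n : 128 * (N : ℝ) ^ 2 ≤ n := by linarith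
  have hL : 2 * (N + m + 1) + 2 ≤ n := by
    have h3 : 128 * N ^ 2 ≤ n := by exact_mod_cast hN2n
    nlinarith
  have ha0 : 0 ≤ c * σ := by positivity
  have ha : c * σ ≤ 1 / 4 := by nlinarith
  have hNN : (N : ℝ) * (4 * (c * σ) + (4 * ((N + m + 1 : ℕ) : ℝ) + 2) / n) ≤ 1 / 2 := by
    have h1 : (4 * ((N + m + 1 : ℕ) : ℝ) + 2) ≤ 5 * N := by
      have : 4 * (N + m + 1) + 2 ≤ 5 * N := by omega
      exact_mod_cast this
    have h2 : (4 * ((N + m + 1 : ℕ) : ℝ) + 2) / n ≤ 5 * N / n := by gcongr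
    have h3 : (N : ℝ) * (5 * N / n) ≤ 5 / 128 := by
      rw [← mul_div_assoc, div_le_iff₀ hn0]; nlinarith
    have h4 : (N : ℝ) * (4 * (c * σ)) ≤ 1 / 8 := by nlinarith
    have h5 := mul_le_mul_of_nonneg_left h2 (by positivity : (0 : ℝ) ≤ N)
    rw [mul_add]; linarith
  have hT := bt_nonneg (p := 1 / 2 - c * σ) (by linarith) (by linarith) n ((n + 1) / 2 + m)
  constructor
  · refine (bt_shift ha0 ha n m N k hL hNN (by omega) (by omega)).trans ?_
    refine mul_le_mul_of_nonneg_right ?_ hT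
    have : 4 * (k : ℝ) / N ≤ 128 * k * σ := by
      rw [div_le_iff₀ (by linarith)]
      have : 1 ≤ 32 * (N * σ) := by
        rw [div_le_iff₀ (by positivity)] at hNge; linarith
      have hk0 : (0 : ℝ) ≤ k := by positivity
      nlinarith
    linarith
  · refine le_trans ?_ (bt_lower ha0 ha n m N hL hNN (by omega))
    have hcen := bp_central ha0 ha n (by exact_mod_cast hn0)
    set u : ℝ := 4 * c ^ 2 * σ ^ 2 with hu
    have hu1 : u ≤ 1 / 2 := by
      have q1 : (c * σ) ^ 2 ≤ (1 / 4) ^ 2 := by gcongr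
      rw [hu]; linarith
    have hu0 : 0 ≤ u := by positivity
    have hpow : Real.exp (-(2 * c ^ 2 + θ) * Real.log d) ≤ (1 - 4 * (c * σ) ^ 2) ^ (n / 2) := by
      have e : 1 - 4 * (c * σ) ^ 2 = 1 - u := by rw [hu]; ring
      have hpos : 0 < 1 - u := by linarith
      rw [e, ← Real.exp_log (pow_pos hpos _), Real.exp_le_exp, Real.log_pow]
      have h1 := Real.one_sub_inv_le_log_of_pos hpos
      have h2 : ((n / 2 : ℕ) : ℝ) ≤ (d + K) / 2 := by
        have : 2 * (n / 2) ≤ d + K := by omega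
        have : 2 * ((n / 2 : ℕ) : ℝ) ≤ d + K := by exact_mod_cast this
        linarith
      have h3 : 1 - (1 - u)⁻¹ = -(u / (1 - u)) := by field_simp; ring
      rw [h3] at h1
      have h4 : ((n / 2 : ℕ) : ℝ) * (u / (1 - u)) ≤ (d + K) / 2 * (u / (1 - u)) := by
        gcongr
      have h5 : (d + K) / 2 * (u / (1 - u)) ≤ (2 * c ^ 2 + θ) * Real.log d := by
        rw [← mul_div_assoc, div_le_iff₀ hpos]
        have : ((d : ℝ) + K) / 2 * u = (2 * c ^ 2 * (1 + K / d)) * Real.log d := by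
          rw [← hσd, hu]; field_simp; ring
        rw [this]
        calc _ ≤ ((2 * c ^ 2 + θ) * (1 - u)) * Real.log d := by gcongr
          _ = _ := by ring
      have h6 := mul_le_mul_of_nonneg_left h1 (by positivity : (0 : ℝ) ≤ ((n / 2 : ℕ) : ℝ))
      linarith
    have hsq : Real.sqrt ((n : ℝ) + 1) ≤ 2 * Real.sqrt d := by
      have : (n : ℝ) + 1 ≤ 2 ^ 2 * d := by
        have : n + 1 ≤ 2 ^ 2 * d := by omega
        exact_mod_cast this
      calc _ ≤ Real.sqrt (2 ^ 2 * d) := Real.sqrt_le_sqrt this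
        _ = _ := by rw [Real.sqrt_mul (by positivity), Real.sqrt_sq (by norm_num)]
    have hsqd : Real.sqrt (Real.log d) = σ * Real.sqrt d := by
      rw [← hσd, Real.sqrt_mul (by positivity), Real.sqrt_sq hσ0.le]
    set X := Real.exp (-(2 * c ^ 2 + θ) * Real.log d) with hX
    have hX0 : 0 < X := Real.exp_pos _
    have hsd : 0 < Real.sqrt d := Real.sqrt_pos.2 hd0
    have hsn : 0 < Real.sqrt ((n : ℝ) + 1) := Real.sqrt_pos.2 (by positivity)
    have hY0 : 0 ≤ (1 - 4 * (c * σ) ^ 2) ^ (n / 2) := hX0.le.trans hpow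
    calc X / (1024 * Real.sqrt (Real.log d)) = (1 / (32 * σ)) / 4 * (X / (4 * (2 * Real.sqrt d))) := by
          rw [hsqd]; field_simp; norm_num
      _ ≤ N / 4 * (X / (4 * (2 * Real.sqrt d))) := by gcongr
      _ ≤ N / 4 * ((1 - 4 * (c * σ) ^ 2) ^ (n / 2) / (4 * Real.sqrt (n + 1))) := by gcongr
      _ ≤ _ := by gcongr

lemma analytic (K m k : ℕ) (c ε : ℝ) (hc0 : 0 < c) (hc : c < 1 / 2) (hε : 0 < ε) :
    ∃ D₀ : ℕ, 2 ≤ D₀ ∧ ∀ d : ℕ, D₀ ≤ d → ∃ η τ p : ℝ,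
      p = 1 / 2 - c * Real.sqrt (Real.log d / d) ∧ 0 ≤ p ∧ p ≤ 1 / 2 ∧ 0 ≤ η ∧ 0 < τ ∧
      (∀ n : ℕ, n ≤ d + K → d ≤ n + K →
        bt p n ((n + 1) / 2 + m - k) ≤ (1 + η) * bt p n ((n + 1) / 2 + m) ∧
        τ ≤ bt p n ((n + 1) / 2 + m)) ∧
      ((1 + η) ^ 2 - 1 + 3 / (d * τ / 2)) / (τ / 2) ≤ ε := by
  set θ : ℝ := (1 / 2 - 2 * c ^ 2) / 2 with hθ
  have hθ0 : 0 < θ := by rw [hθ]; nlinarith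
  set α : ℝ := 2 * c ^ 2 + θ with hα
  have hα1 : α < 1 / 2 := by rw [hα, hθ]; nlinarith
  have hσt : Tendsto (fun d : ℕ => Real.sqrt (Real.log d / (d : ℝ))) atTop (nhds 0) := by
    have := (Real.continuous_sqrt.tendsto 0).comp tendsto_log_div
    rw [Real.sqrt_zero] at this
    exact this
  have hKd : Tendsto (fun d : ℕ => (K : ℝ) / d) atTop (nhds 0) :=
    tendsto_const_nhds.div_atTop tendsto_natCast_atTop_atTop
  have e1 : ∀ᶠ d : ℕ in atTop, 1 ≤ Real.log d :=
    (Real.tendsto_log_atTop.comp tendsto_natCast_atTop_atTop).eventually_ge_atTop 1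
  have e2 : ∀ᶠ d : ℕ in atTop, Real.sqrt (Real.log d / (d : ℝ)) <
      1 / (32 * (2 * k + 4 * m + 6 : ℝ)) :=
    hσt.eventually_lt_const (by positivity)
  have e2' : ∀ᶠ d : ℕ in atTop, Real.sqrt (Real.log d / (d : ℝ)) < 1 / (128 * (k + 1)) :=
    hσt.eventually_lt_const (by positivity)
  have e3 : ∀ᶠ d : ℕ in atTop, 2 * c ^ 2 * (1 + K / d) <
      (2 * c ^ 2 + θ) * (1 - 4 * c ^ 2 * Real.sqrt (Real.log d / (d : ℝ)) ^ 2) := by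
    have l1 : Tendsto (fun d : ℕ => 2 * c ^ 2 * (1 + (K : ℝ) / d)) atTop
        (nhds (2 * c ^ 2 * (1 + 0))) := (hKd.const_add 1).const_mul _
    have l2 : Tendsto (fun d : ℕ => (2 * c ^ 2 + θ) *
        (1 - 4 * c ^ 2 * Real.sqrt (Real.log d / (d : ℝ)) ^ 2)) atTop
        (nhds ((2 * c ^ 2 + θ) * (1 - 4 * c ^ 2 * 0 ^ 2))) :=
      (((hσt.pow 2).const_mul _).const_sub 1).const_mul _
    exact l1.eventually_lt l2 (by simp; linarith)
  have e4 : ∀ᶠ d : ℕ in atTop, Real.log d * Real.exp ((α - 1 / 2) * Real.log d) <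
      ε / (2 * (768 * 1024 * (k + 1))) :=
    (tendsto_log_mul_rpow _ (by linarith)).eventually_lt_const (by positivity)
  have e5 : ∀ᶠ d : ℕ in atTop, Real.log d * Real.exp ((2 * α - 1) * Real.log d) <
      ε / (2 * (12 * 1024 ^ 2)) :=
    (tendsto_log_mul_rpow _ (by linarith)).eventually_lt_const (by positivity)
  obtain ⟨D, hD⟩ := eventually_atTop.1 ((((((e1.and e2).and e2').and e3).and e4).and e5).and
    (eventually_ge_atTop (2 * K + 2)))
  refine ⟨max D 2, le_max_right _ _, fun d hd => ?_⟩
  obtain ⟨⟨⟨⟨⟨⟨e1, e2⟩, e2'⟩, e3⟩, e4⟩, e5⟩, e6⟩ := hD d (le_trans (le_max_left _ _) hd)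
  set σ := Real.sqrt (Real.log d / (d : ℝ)) with hσ
  have hd0 : (0 : ℝ) < d := by exact_mod_cast (by omega : 0 < d)
  have hσ0 : 0 < σ := Real.sqrt_pos.2 (by positivity)
  have hσ2 : σ ^ 2 = Real.log d / d := Real.sq_sqrt (by positivity)
  have hσd : σ ^ 2 * d = Real.log d := by rw [hσ2]; field_simp
  set lg := Real.log d with hlg
  have hk0 : (0 : ℝ) ≤ k := by positivity
  have hm0 : (0 : ℝ) ≤ m := by positivity
  have hσ1 : 2 * k + 4 * m + 6 ≤ 1 / (32 * σ) := by
    rw [lt_div_iff₀ (by positivity)] at e2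
    rw [le_div_iff₀ (by positivity)]; linarith
  have hσs : σ ≤ 1 / 4 := by
    rw [lt_div_iff₀ (by positivity)] at e2'
    nlinarith
  set τ := Real.exp (-α * lg) / (1024 * Real.sqrt lg) with hτ
  have hsl : 0 < Real.sqrt lg := Real.sqrt_pos.2 (by linarith)
  have hτ0 : 0 < τ := by positivity
  refine ⟨128 * k * σ, τ, 1 / 2 - c * σ, rfl, by nlinarith, by nlinarith, by positivity, hτ0,
    fun n hn1 hn2 => analytic_core K m k c θ hc0 hc hθ0 d n σ hσ0 hσd e1 hσ1 e6 e3.le hn1 hn2, ?_⟩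
  have hη1 : 128 * k * σ ≤ 1 := by
    rw [lt_div_iff₀ (by positivity)] at e2'
    nlinarith
  have hη : (1 + 128 * k * σ) ^ 2 - 1 ≤ 3 * (128 * (k + 1) * σ) := by
    have : 0 ≤ 128 * k * σ := by positivity
    nlinarith
  have hsq : Real.sqrt lg ^ 2 = lg := Real.sq_sqrt (by linarith)
  have hlogd : Real.exp lg = d := Real.exp_log hd0
  have t1 : σ / τ = 1024 * (lg * Real.exp ((α - 1 / 2) * lg)) := by
    have hs : σ = Real.sqrt lg * Real.exp (-(1 / 2) * lg) := by
      rw [hσ, Real.sqrt_div (by linarith), div_eq_mul_inv]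
      congr 1
      rw [← hlogd, Real.sqrt_eq_rpow, ← Real.exp_mul, ← Real.exp_neg]
      congr 1; ring
    have he : Real.exp ((α - 1 / 2) * lg) = Real.exp (-(1 / 2) * lg) / Real.exp (-α * lg) := by
      rw [← Real.exp_sub]; congr 1; ring
    have hl2 : lg * (Real.exp (-(1 / 2) * lg) / Real.exp (-α * lg)) =
        Real.sqrt lg ^ 2 * (Real.exp (-(1 / 2) * lg) / Real.exp (-α * lg)) := by rw [hsq]
    rw [he, hτ, hs, hl2]
    generalize Real.sqrt lg = w at hsl
    field_simp
  have t2 : 1 / (d * τ ^ 2) = 1024 ^ 2 * (lg * Real.exp ((2 * α - 1) * lg)) := by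
    have he : Real.exp ((2 * α - 1) * lg) = 1 / (Real.exp lg * Real.exp (-α * lg) ^ 2) := by
      rw [← Real.exp_nat_mul, ← Real.exp_add, one_div, ← Real.exp_neg]
      congr 1; push_cast; ring
    rw [he, hlogd, hτ, div_pow, mul_pow, hsq]
    field_simp
  calc ((1 + 128 * k * σ) ^ 2 - 1 + 3 / (d * τ / 2)) / (τ / 2)
      ≤ (3 * (128 * (k + 1) * σ) + 3 / (d * τ / 2)) / (τ / 2) := by gcongr
    _ = 768 * (k + 1) * (σ / τ) + 12 * (1 / (d * τ ^ 2)) := by field_simp; ring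
    _ = 768 * 1024 * (k + 1) * (lg * Real.exp ((α - 1 / 2) * lg)) +
        12 * 1024 ^ 2 * (lg * Real.exp ((2 * α - 1) * lg)) := by rw [t1, t2]; ring
    _ ≤ 768 * 1024 * (k + 1) * (ε / (2 * (768 * 1024 * (k + 1)))) +
        12 * 1024 ^ 2 * (ε / (2 * (12 * 1024 ^ 2))) := by gcongr
    _ = ε := by field_simp; ring

end Asymptotics

section Graph

/-- The structural input extracted from membership in `H(K)`. -/
lemma structure_of_InH (K : ℕ) {V : Type} [Finite V] (G : SimpleGraph V) (hH : InH K G) (x : V)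
    (hd : 1 ≤ deg G x) :
    (∀ y, G.Adj x y → deg G y ≤ deg G x + K ∧ deg G x ≤ deg G y + K) ∧
    ∃ D : Set V, (D ∩ G.neighborSet x).ncard ≤ 1 ∧
      ∀ y z, G.Adj x y → G.Adj x z → y ∉ D → z ∉ D → y ≠ z →
        (G.neighborSet y ∩ G.neighborSet z).ncard ≤ 2 * K + 1 := by
  have hcard : Nat.card V ≠ 1 := by
    intro h
    have hs : Subsingleton V := (Nat.card_eq_one_iff_unique.1 h).1
    have : G.neighborSet x = ∅ := by
      ext y
      simp only [SimpleGraph.mem_neighborSet, Set.mem_empty_iff_false, iff_false]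
      intro hxy
      exact hxy.ne (Subsingleton.elim _ _)
    rw [deg, this] at hd
    simp at hd
  have hall : P1 K G ∧ P2 K G ∧ P3 K G := by
    obtain ⟨n, hn⟩ := hH
    cases n with
    | zero => exact absurd hn hcard
    | succ n =>
      rcases hn with hn | ⟨h1, h2, h3, -, -⟩
      · exact absurd hn hcard
      · exact ⟨h1, h2, h3⟩
  obtain ⟨h1, h2, h3⟩ := hall
  have hsph : ∀ y, G.Adj x y → y ∈ sphere G x 1 := by
    intro y hy
    simp only [sphere, Set.mem_setOf_eq]
    exact_mod_cast SimpleGraph.edist_eq_one_iff_adj.2 hy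
  have hsph' : sphere G x 1 = G.neighborSet x := by
    ext y
    simp only [sphere, Set.mem_setOf_eq, SimpleGraph.mem_neighborSet]
    exact_mod_cast SimpleGraph.edist_eq_one_iff_adj
  refine ⟨fun y hy => ?_, ?_⟩
  · have := h1 x 1 le_rfl y (hsph y hy)
    rw [abs_le] at this
    push_cast at this
    constructor <;> omega
  · obtain ⟨D, hxD, hD⟩ := h3 x
    obtain ⟨d1, d2, d3, -⟩ := hD 1 le_rfl
    refine ⟨D, ?_, ?_⟩
    · rw [← hsph']; simpa using d1
    · intro y z hy hz hyD hzD hyz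
      have b1 := h2 x 1 le_rfl y (hsph y hy)
      have b2 := d2 y ⟨hsph y hy, hyD⟩
      have b3 := d3 y ⟨hsph y hy, hyD⟩ z ⟨hsph z hz, hzD⟩ hyz
      have hsub : G.neighborSet y ∩ G.neighborSet z ⊆
          (G.neighborSet y ∩ ball G x 1) ∪ ((D ∩ G.neighborSet y) ∪
            (G.neighborSet y ∩ G.neighborSet z ∩ (sphere G x (1 + 1) \ D))) := by
        rintro w ⟨hwy, hwz⟩
        by_cases hwD : w ∈ D
        · exact Or.inr (Or.inl ⟨hwD, hwy⟩)
        by_cases hb : w ∈ ball G x 1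
        · exact Or.inl ⟨hwy, hb⟩
        refine Or.inr (Or.inr ⟨⟨hwy, hwz⟩, ?_, hwD⟩)
        simp only [sphere, ball, Set.mem_setOf_eq] at hb ⊢
        have e1 : G.edist x y = 1 := SimpleGraph.edist_eq_one_iff_adj.2 hy
        have e2 : G.edist y w = 1 := SimpleGraph.edist_eq_one_iff_adj.2 hwy
        have tri := SimpleGraph.edist_triangle (G := G) (u := x) (v := y) (w := w)
        rw [e1, e2] at tri
        push_neg at hb
        apply le_antisymm
        · exact_mod_cast tri
        · have := Order.add_one_le_of_lt hb
          exact_mod_cast this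
      calc (G.neighborSet y ∩ G.neighborSet z).ncard ≤ _ := Set.ncard_le_ncard hsub (Set.toFinite _)
        _ ≤ _ := Set.ncard_union_le _ _
        _ ≤ _ := Nat.add_le_add_left (Set.ncard_union_le _ _) _
        _ ≤ _ := by omega

variable {V : Type} [Fintype V] [DecidableEq V]

open Classical in
/-- Neighbourhood as a finset. -/
noncomputable def nbr (G : SimpleGraph V) (y : V) : Finset V :=
  Finset.univ.filter (fun z => G.Adj y z)

lemma mem_nbr (G : SimpleGraph V) (y z : V) : z ∈ nbr G y ↔ G.Adj y z := by simp [nbr]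

lemma coe_nbr (G : SimpleGraph V) (y : V) : (nbr G y : Set V) = G.neighborSet y := by
  ext z; simp [nbr]

lemma card_nbr (G : SimpleGraph V) (y : V) : (nbr G y).card = deg G y := by
  rw [deg, ← coe_nbr, Set.ncard_coe_finset]

/-- Integer threshold for infection of `y`. -/
noncomputable def thr (G : SimpleGraph V) (m : ℕ) (y : V) : ℕ := (deg G y + 1) / 2 + m

lemma thr_iff (G : SimpleGraph V) (m : ℕ) (y : V) (j : ℕ) :
    (deg G y : ℝ) / 2 + m ≤ (j : ℝ) ↔ thr G m y ≤ j := by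
  have : (deg G y : ℝ) / 2 + m ≤ (j : ℝ) ↔ deg G y + 2 * m ≤ 2 * j := by
    rw [← @Nat.cast_le ℝ]
    push_cast
    constructor <;> intro h <;> linarith
  rw [this, thr]
  omega

/-- Indicator that `y` is newly infected in the first round. -/
noncomputable def ind (G : SimpleGraph V) (m : ℕ) (y : V) (A : Finset V) : ℝ :=
  (if y ∉ A then (1 : ℝ) else 0) * (if thr G m y ≤ (nbr G y ∩ A).card then (1 : ℝ) else 0)

lemma ind_nonneg (G : SimpleGraph V) (m : ℕ) (y : V) (A : Finset V) : 0 ≤ ind G m y A := by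
  unfold ind; split_ifs <;> simp

lemma ind_le_one (G : SimpleGraph V) (m : ℕ) (y : V) (A : Finset V) : ind G m y A ≤ 1 := by
  unfold ind; split_ifs <;> simp

lemma count_eq (G : SimpleGraph V) (m : ℕ) (x : V) (A : Finset V) :
    ((G.neighborSet x ∩ (bootIterM G m (A : Set V) 1 \ (A : Set V))).ncard : ℝ) =
      ∑ y ∈ nbr G x, ind G m y A := by
  have h : G.neighborSet x ∩ (bootIterM G m (A : Set V) 1 \ (A : Set V)) =
      (((nbr G x).filter fun y => y ∉ A ∧ thr G m y ≤ (nbr G y ∩ A).card : Finset V) : Set V) := by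
    ext y
    have e : (G.neighborSet y ∩ (A : Set V)).ncard = (nbr G y ∩ A).card := by
      rw [← coe_nbr, ← Finset.coe_inter, Set.ncard_coe_finset]
    simp only [bootIterM, bootStepM, Set.mem_inter_iff, Set.mem_diff, Set.mem_union,
      Set.mem_setOf_eq, Finset.coe_filter, mem_nbr, SimpleGraph.mem_neighborSet, e, thr_iff,
      Finset.mem_coe]
    tauto
  rw [h, Set.ncard_coe_finset, Finset.card_filter, Nat.cast_sum]
  refine Finset.sum_congr rfl fun y _ => ?_
  unfold ind
  by_cases h1 : y ∉ A <;> by_cases h2 : thr G m y ≤ (nbr G y ∩ A).card <;> simp [h1, h2]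

lemma notMem_local (y : V) (S : Finset V) (hy : y ∈ S) (A : Finset V) :
    (if y ∉ A then (1 : ℝ) else 0) = if y ∉ A ∩ S then (1 : ℝ) else 0 := by
  simp [hy]

lemma tail_local (U S : Finset V) (hU : U ⊆ S) (t : ℕ) (A : Finset V) :
    (if t ≤ (U ∩ A).card then (1 : ℝ) else 0) =
      if t ≤ (U ∩ (A ∩ S)).card then (1 : ℝ) else 0 := by
  have : U ∩ (A ∩ S) = U ∩ A := by
    ext a
    have := @hU a
    simp only [Finset.mem_inter]; tauto
  rw [this]

lemma EE_ind (p : ℝ) (U : Finset V) (t : ℕ) (y : V) (hy : y ∉ U) :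
    EE p (fun A => (if y ∉ A then (1 : ℝ) else 0) * (if t ≤ (U ∩ A).card then (1 : ℝ) else 0)) =
      (1 - p) * bt p U.card t := by
  rw [EE_indep p {y} U (by simpa using hy) _ _ (notMem_local y {y} (by simp))
    (tail_local U U subset_rfl t), EE_notMem, EE_tail]

lemma EE_pair {p : ℝ} (h0 : 0 ≤ p) (h1 : p ≤ 1) (G : SimpleGraph V) (m k : ℕ) (y z : V)
    (hyz : y ≠ z) (hk : (nbr G y ∩ nbr G z).card + 2 ≤ k) :
    EE p (fun A => ind G m y A * ind G m z A) ≤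
      ((1 - p) * bt p (deg G y) (thr G m y - k)) * ((1 - p) * bt p (deg G z) (thr G m z - k)) := by
  set C : Finset V := (nbr G y ∩ nbr G z) ∪ {y, z} with hC
  have hCk : C.card ≤ k := by
    refine (Finset.card_union_le _ _).trans (le_trans ?_ hk)
    exact Nat.add_le_add_left Finset.card_le_two _
  set U := nbr G y \ C with hU
  set W := nbr G z \ C with hW
  have hyU : y ∉ U := by simp [hU, hC]
  have hzU : z ∉ U := by simp [hU, hC]
  have hyW : y ∉ W := by simp [hW, hC]
  have hzW : z ∉ W := by simp [hW, hC]
  have hUW : Disjoint U W := by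
    rw [Finset.disjoint_left]
    intro a ha hb
    simp only [hU, hW, hC, Finset.mem_sdiff, Finset.mem_union, Finset.mem_inter] at ha hb
    tauto
  have low : ∀ (v : V) (A : Finset V), thr G m v ≤ (nbr G v ∩ A).card →
      thr G m v - k ≤ ((nbr G v \ C) ∩ A).card := by
    intro v A h
    have : nbr G v ∩ A ⊆ ((nbr G v \ C) ∩ A) ∪ C := by
      intro a
      simp only [Finset.mem_union, Finset.mem_inter, Finset.mem_sdiff]
      tauto
    have := (Finset.card_le_card this).trans (Finset.card_union_le _ _)
    omega
  have ile : ∀ (v : V) (A : Finset V), ind G m v A ≤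
      (if v ∉ A then (1 : ℝ) else 0) *
        (if thr G m v - k ≤ ((nbr G v \ C) ∩ A).card then (1 : ℝ) else 0) := by
    intro v A
    unfold ind
    by_cases hA : thr G m v ≤ (nbr G v ∩ A).card
    · rw [if_pos hA, if_pos (low v A hA)]
    · rw [if_neg hA, mul_zero]
      split_ifs <;> simp
  have tle : ∀ v : V, bt p (nbr G v \ C).card (thr G m v - k) ≤ bt p (deg G v) (thr G m v - k) := by
    intro v
    rw [← card_nbr, ← EE_tail, ← EE_tail]
    refine EE_mono h0 h1 fun A => ?_
    by_cases hA : thr G m v - k ≤ ((nbr G v \ C) ∩ A).card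
    · have : thr G m v - k ≤ (nbr G v ∩ A).card :=
        hA.trans (Finset.card_le_card (Finset.inter_subset_inter_right Finset.sdiff_subset))
      rw [if_pos hA, if_pos this]
    · rw [if_neg hA]; split_ifs <;> simp
  have hq : 0 ≤ 1 - p := by linarith
  calc EE p (fun A => ind G m y A * ind G m z A)
      ≤ EE p (fun A => ((if y ∉ A then (1 : ℝ) else 0) *
          (if thr G m y - k ≤ (U ∩ A).card then (1 : ℝ) else 0)) *
          ((if z ∉ A then (1 : ℝ) else 0) *
          (if thr G m z - k ≤ (W ∩ A).card then (1 : ℝ) else 0))) := by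
        refine EE_mono h0 h1 fun A => ?_
        refine mul_le_mul (ile y A) (ile z A) (ind_nonneg _ _ _ _) ?_
        split_ifs <;> simp
    _ = ((1 - p) * bt p U.card (thr G m y - k)) * ((1 - p) * bt p W.card (thr G m z - k)) := by
        rw [EE_indep p (insert y U) (insert z W) ?_ _ _ ?_ ?_, EE_ind p U _ y hyU,
          EE_ind p W _ z hzW]
        · rw [Finset.disjoint_left] at hUW ⊢
          intro a ha hb
          rw [Finset.mem_insert] at ha hb
          rcases ha with rfl | ha <;> rcases hb with rfl | hb
          · exact hyz rfl
          · exact hyW hb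
          · exact hzU ha
          · exact hUW ha hb
        · intro A
          rw [notMem_local y (insert y U) (by simp) A,
            tail_local U (insert y U) (Finset.subset_insert _ _) _ A]
        · intro A
          rw [notMem_local z (insert z W) (by simp) A,
            tail_local W (insert z W) (Finset.subset_insert _ _) _ A]
    _ ≤ _ := by
        have b1 := bt_nonneg h0 h1 U.card (thr G m y - k)
        have b2 := bt_nonneg h0 h1 W.card (thr G m z - k)
        have b3 := bt_nonneg h0 h1 (deg G y) (thr G m y - k)
        have := tle y
        have := tle z
        gcongr

lemma second_moment {p : ℝ} (h0 : 0 ≤ p) (h1 : p ≤ 1) (G : SimpleGraph V) (m k : ℕ) (x : V)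
    (η : ℝ) (hη : 0 ≤ η) (D : Set V) (hD : (D ∩ G.neighborSet x).ncard ≤ 1)
    (hcom : ∀ y z, G.Adj x y → G.Adj x z → y ∉ D → z ∉ D → y ≠ z →
        (G.neighborSet y ∩ G.neighborSet z).ncard + 2 ≤ k)
    (hsm : ∀ y, G.Adj x y →
      bt p (deg G y) (thr G m y - k) ≤ (1 + η) * bt p (deg G y) (thr G m y)) (μ : ℝ)
    (hμ : EE p (fun A => ∑ y ∈ nbr G x, ind G m y A) = μ) :
    EE p (fun A => (∑ y ∈ nbr G x, ind G m y A) ^ 2) ≤ (1 + η) ^ 2 * μ ^ 2 + 3 * μ := by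
  classical
  have hq : 0 ≤ 1 - p := by linarith
  set P : V → ℝ := fun y => EE p (ind G m y) with hP
  have hPe : ∀ y, P y = (1 - p) * bt p (deg G y) (thr G m y) := by
    intro y
    have := EE_ind p (nbr G y) (thr G m y) y (by simp [mem_nbr])
    rw [card_nbr] at this
    exact this
  have hP0 : ∀ y, 0 ≤ P y := fun y => by
    rw [hPe]; exact mul_nonneg hq (bt_nonneg h0 h1 _ _)
  have hμP : μ = ∑ y ∈ nbr G x, P y := by
    rw [← hμ, EE, EU_sum]; rfl
  have hexp : EE p (fun A => (∑ y ∈ nbr G x, ind G m y A) ^ 2) =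
      ∑ y ∈ nbr G x, ∑ z ∈ nbr G x, EE p (fun A => ind G m y A * ind G m z A) := by
    have : (fun A => (∑ y ∈ nbr G x, ind G m y A) ^ 2) =
        fun A => ∑ y ∈ nbr G x, ∑ z ∈ nbr G x, ind G m y A * ind G m z A := by
      ext A
      rw [sq, Finset.sum_mul_sum]
    rw [this, EE, EU_sum]
    refine Finset.sum_congr rfl fun y _ => ?_
    rw [EU_sum]; rfl
  have le1 : ∀ y z, EE p (fun A => ind G m y A * ind G m z A) ≤ P y := fun y z =>
    EE_mono h0 h1 fun A => mul_le_of_le_one_right (ind_nonneg _ _ _ _) (ind_le_one _ _ _ _)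
  have le2 : ∀ y z, EE p (fun A => ind G m y A * ind G m z A) ≤ P z := fun y z =>
    EE_mono h0 h1 fun A => mul_le_of_le_one_left (ind_nonneg _ _ _ _) (ind_le_one _ _ _ _)
  have hpt : ∀ y ∈ nbr G x, ∀ z ∈ nbr G x, EE p (fun A => ind G m y A * ind G m z A) ≤
      (1 + η) ^ 2 * (P y * P z) + (if y = z then P y else 0) + (if y ∈ D then P z else 0) +
        (if z ∈ D then P y else 0) := by
    intro y hy z hz
    have hbase : 0 ≤ (1 + η) ^ 2 * (P y * P z) := by
      have := hP0 y
      have := hP0 z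
      positivity
    have n1 : 0 ≤ (if y = z then P y else 0) := by split_ifs; exacts [hP0 y, le_rfl]
    have n2 : 0 ≤ (if y ∈ D then P z else 0) := by split_ifs; exacts [hP0 z, le_rfl]
    have n3 : 0 ≤ (if z ∈ D then P y else 0) := by split_ifs; exacts [hP0 y, le_rfl]
    by_cases c1 : y = z
    · have := le1 y z
      rw [if_pos c1] at n1 ⊢; linarith
    by_cases c2 : y ∈ D
    · have := le2 y z
      rw [if_pos c2] at n2 ⊢; linarith
    by_cases c3 : z ∈ D
    · have := le1 y z
      rw [if_pos c3] at n3 ⊢; linarith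
    rw [mem_nbr] at hy hz
    have hk := hcom y z hy hz c2 c3 c1
    rw [← coe_nbr, ← coe_nbr, ← Finset.coe_inter, Set.ncard_coe_finset] at hk
    have hp := EE_pair h0 h1 G m k y z c1 hk
    have : ((1 - p) * bt p (deg G y) (thr G m y - k)) * ((1 - p) * bt p (deg G z) (thr G m z - k))
        ≤ (1 + η) ^ 2 * (P y * P z) := by
      have b2 := bt_nonneg h0 h1 (deg G z) (thr G m z - k)
      have b3 := bt_nonneg h0 h1 (deg G y) (thr G m y)
      calc _ ≤ ((1 - p) * ((1 + η) * bt p (deg G y) (thr G m y))) *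
            ((1 - p) * ((1 + η) * bt p (deg G z) (thr G m z))) := by
            have := hsm y hy
            have := hsm z hz
            gcongr
        _ = _ := by rw [hPe, hPe]; ring
    linarith
  have hDc : (((nbr G x).filter (· ∈ D)).card : ℝ) ≤ 1 := by
    have e : (((nbr G x).filter (· ∈ D) : Finset V) : Set V) = D ∩ G.neighborSet x := by
      ext a; simp [mem_nbr]; tauto
    rw [← e, Set.ncard_coe_finset] at hD
    exact_mod_cast hD
  have hμ0 : 0 ≤ μ := by rw [hμP]; exact Finset.sum_nonneg fun y _ => hP0 y
  rw [hexp]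
  refine (Finset.sum_le_sum fun y hy => Finset.sum_le_sum fun z hz => hpt y hy z hz).trans ?_
  simp only [Finset.sum_add_distrib]
  have s1 : ∑ y ∈ nbr G x, ∑ z ∈ nbr G x, (1 + η) ^ 2 * (P y * P z) = (1 + η) ^ 2 * μ ^ 2 := by
    rw [hμP, sq (∑ y ∈ nbr G x, P y), Finset.sum_mul_sum, Finset.mul_sum]
    exact Finset.sum_congr rfl fun y _ => by rw [Finset.mul_sum]
  have s2 : ∑ y ∈ nbr G x, ∑ z ∈ nbr G x, (if y = z then P y else 0) = μ := by
    rw [hμP]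
    refine Finset.sum_congr rfl fun y hy => ?_
    rw [Finset.sum_ite_eq, if_pos hy]
  have s3 : ∑ y ∈ nbr G x, ∑ z ∈ nbr G x, (if y ∈ D then P z else 0) ≤ μ := by
    have : ∑ y ∈ nbr G x, ∑ z ∈ nbr G x, (if y ∈ D then P z else 0) =
        (((nbr G x).filter (· ∈ D)).card : ℝ) * μ := by
      rw [← nsmul_eq_mul, ← Finset.sum_const, Finset.sum_filter, hμP]
      refine Finset.sum_congr rfl fun y _ => ?_
      split_ifs <;> simp
    rw [this]
    exact mul_le_of_le_one_left hμ0 hDc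
  have s4 : ∑ y ∈ nbr G x, ∑ z ∈ nbr G x, (if z ∈ D then P y else 0) ≤ μ := by
    rw [Finset.sum_comm]; exact s3
  linarith

end Graph

/-- conditional variance of the number of neighbours infected in round one. -/
theorem statement11 (K m : ℕ) (c ε : ℝ) (hc0 : 0 < c) (hc : c < 1 / 2) (hε : 0 < ε) :
    ∃ D₀ : ℕ, ∀ (V : Type) [Finite V], ∀ G : SimpleGraph V,
      InH K G → D₀ ≤ minDeg G → ∀ x : V, ∀ ℓ : ℕ,
      m ≤ ℓ → (ℓ : ℝ) ≤ (deg G x : ℝ) / 2 + m →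
      condVar (1 / 2 - c * Real.sqrt (Real.log (deg G x) / (deg G x)))
          (fun A0 => x ∉ A0 ∧
            (deg G x : ℝ) / 2 + m - ℓ ≤ ((G.neighborSet x ∩ A0).ncard : ℝ))
          (fun A0 => ((G.neighborSet x ∩ (bootIterM G m A0 1 \ A0)).ncard : ℝ))
        ≤ ε *
          (condExp (1 / 2 - c * Real.sqrt (Real.log (deg G x) / (deg G x)))
            (fun A0 => x ∉ A0 ∧
              (deg G x : ℝ) / 2 + m - ℓ ≤ ((G.neighborSet x ∩ A0).ncard : ℝ))
            (fun A0 => ((G.neighborSet x ∩ (bootIterM G m A0 1 \ A0)).ncard : ℝ))) ^ 2 := by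
  have hε' : 0 < min (1 / 4) (ε / 4) := lt_min (by norm_num) (by linarith)
  obtain ⟨D₀, hD2, hD₀⟩ := analytic K m (2 * K + 3) c (min (1 / 4) (ε / 4)) hc0 hc hε'
  refine ⟨D₀, fun V _ G hH hmin x ℓ hℓ _ => ?_⟩
  classical
  obtain ⟨_⟩ := nonempty_fintype V
  have hdx : D₀ ≤ deg G x := hmin.trans (Nat.sInf_le ⟨x, rfl⟩)
  obtain ⟨η, τ, p, hp, h0, h12, hη, hτ, hbt, hfin⟩ := hD₀ (deg G x) hdx
  have h1 : p ≤ 1 := by linarith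
  obtain ⟨hreg, D, hDc, hcom⟩ := structure_of_InH K G hH x (by omega)
  rw [← hp]
  have hd0 : (0 : ℝ) < deg G x := by exact_mod_cast (by omega : 0 < deg G x)
  set f : Set V → ℝ := fun A0 => ((G.neighborSet x ∩ (bootIterM G m A0 1 \ A0)).ncard : ℝ) with hf
  have hfe : (fun A : Finset V => f (A : Set V)) = fun A => ∑ y ∈ nbr G x, ind G m y A := by
    ext A; exact count_eq G m x A
  have hfe2 : (fun A : Finset V => f (A : Set V) ^ 2) =
      fun A => (∑ y ∈ nbr G x, ind G m y A) ^ 2 := by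
    ext A; rw [← count_eq G m x A]
  set μ := EE p (fun A => ∑ y ∈ nbr G x, ind G m y A) with hμ
  have hμlow : (deg G x : ℝ) * τ / 2 ≤ μ := by
    rw [hμ, EE, EU_sum]
    have : ∀ y ∈ nbr G x, τ / 2 ≤ EU p Finset.univ (ind G m y) := by
      intro y hy
      rw [mem_nbr] at hy
      have e := EE_ind p (nbr G y) (thr G m y) y (by simp [mem_nbr])
      rw [card_nbr] at e
      have e' : EU p Finset.univ (ind G m y) = (1 - p) * bt p (deg G y) (thr G m y) := e
      rw [e']
      have h2 : τ ≤ bt p (deg G y) (thr G m y) :=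
        (hbt (deg G y) (hreg y hy).1 (hreg y hy).2).2
      nlinarith
    have := Finset.card_nsmul_le_sum _ _ _ this
    rw [card_nbr, nsmul_eq_mul] at this
    linarith
  have hdt : 0 < (deg G x : ℝ) * τ / 2 := by positivity
  have hμ0 : 0 < μ := hdt.trans_le hμlow
  have hsm := second_moment h0 h1 G m (2 * K + 3) x η hη D hDc
    (fun y z hy hz hyD hzD hyz => by have := hcom y z hy hz hyD hzD hyz; omega)
    (fun y hy => (hbt (deg G y) (hreg y hy).1 (hreg y hy).2).1) μ hμ.symm
  set κ : ℝ := (1 + η) ^ 2 - 1 + 3 / (deg G x * τ / 2) with hκ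
  have hκ0 : 0 ≤ κ := by
    have : 0 ≤ (1 + η) ^ 2 - 1 := by nlinarith
    positivity
  have hPE : τ / 2 ≤ prob p (fun A0 : Set V => x ∉ A0 ∧
      (deg G x : ℝ) / 2 + m - ℓ ≤ ((G.neighborSet x ∩ A0).ncard : ℝ)) := by
    rw [prob_eq]
    have e := EE_ind p (nbr G x) (thr G m x) x (by simp [mem_nbr])
    rw [card_nbr] at e
    have h2 : τ ≤ bt p (deg G x) (thr G m x) := (hbt (deg G x) (by omega) (by omega)).2
    have h3 : τ / 2 ≤ (1 - p) * bt p (deg G x) (thr G m x) := by nlinarith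
    refine h3.trans (e.symm.le.trans (EE_mono h0 h1 fun A => ?_))
    by_cases hA : x ∉ A ∧ thr G m x ≤ (nbr G x ∩ A).card
    · have hm : (x ∉ (A : Set V) ∧
          (deg G x : ℝ) / 2 + m - ℓ ≤ ((G.neighborSet x ∩ (A : Set V)).ncard : ℝ)) := by
        refine ⟨by simpa using hA.1, ?_⟩
        rw [← coe_nbr, ← Finset.coe_inter, Set.ncard_coe_finset]
        have := (thr_iff G m x _).2 hA.2
        have hl : (0 : ℝ) ≤ ℓ := by positivity
        linarith
      rw [if_pos hm]
      split_ifs <;> simp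
    · have hz : (if x ∉ A then (1 : ℝ) else 0) *
          (if thr G m x ≤ (nbr G x ∩ A).card then (1 : ℝ) else 0) = 0 := by
        by_cases hx : x ∉ A
        · have : ¬ thr G m x ≤ (nbr G x ∩ A).card := fun h => hA ⟨hx, h⟩
          rw [if_neg this, mul_zero]
        · rw [if_neg hx, zero_mul]
      rw [hz]
      split_ifs <;> simp
  refine cond_transfer h0 h1 _ f μ κ (τ / 2) ε (by rw [hfe]) hμ0.le ?_ (by positivity) hPE hκ0
    (hfin.trans (min_le_left _ _)) (hfin.trans (min_le_right _ _))
  rw [hfe2]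
  refine hsm.trans ?_
  have : 3 * μ ≤ 3 / (deg G x * τ / 2) * μ ^ 2 := by
    rw [div_mul_eq_mul_div, le_div_iff₀ hdt]
    nlinarith
  rw [hκ]
  nlinarith

end MBP
end

section
/- For every K ∈ ℕ and every constant c > 1/2 there exists D₀ such that the following holds. Let G ∈ H(K) be a finite graph with δ(G) ≥ D₀, let x ∈ V(G), write d := d(x), σ := √(log d/d) and γ := √(d/√(log d)), let p := 1/2 − c·σ, let D be a set witnessing property (P3) for x with S₀(x,ℓ) := S(x,ℓ)\D, let A₀ ⊆ V(G) be any initial set, and let (Â_ℓ) be the Boot₂(γ) process started from A₀. If x ∈ Â₃ \ Â₂, then there exist sets W₁ ⊆ S₀(x,1) and W₂ ⊆ S₀(x,2) with W₂ ⊆ N(W₁), |W₁| ≥ γ − 3K and |W₂| ≥ (γ − 3K)²/(2K), such that e(W₂, S₀(x,3) ∩ A₀) ≥ p·e(W₂, S₀(x,3)) + (c·√(d·log d) − 3γ)·|W₂|. -/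
open SimpleGraph Filter

namespace MBP

lemma g_aux {s t : ℝ} {k : ℝ} (hk : 1 ≤ k) (hs : 3 ≤ s) (hst : s ≤ t) (hts : t ≤ s + 2 * k) :
    √(s / √(Real.log s)) ≤ √(t / √(Real.log t)) ∧
    √(t / √(Real.log t)) ≤ √(s / √(Real.log s)) + k := by
  have hls : 1 ≤ Real.log s := by
    rw [Real.le_log_iff_exp_le (by linarith)]
    have := Real.exp_one_lt_d9
    linarith
  have hlt : Real.log s ≤ Real.log t := Real.log_le_log (by linarith) hst
  have ha : 1 ≤ √(Real.log s) := Real.one_le_sqrt.2 hls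
  have hab : √(Real.log s) ≤ √(Real.log t) := Real.sqrt_le_sqrt hlt
  have has : √(Real.log s) ^ 2 = Real.log s := Real.sq_sqrt (by linarith)
  have hbs : √(Real.log t) ^ 2 = Real.log t := Real.sq_sqrt (by linarith)
  have hlog : s * (Real.log t - Real.log s) ≤ t - s := by
    rw [← Real.log_div (by linarith) (by linarith)]
    have h1 := Real.log_le_sub_one_of_pos (x := t / s) (by apply div_pos <;> linarith)
    calc s * Real.log (t / s) ≤ s * (t / s - 1) := by gcongr
      _ = t - s := by field_simp
  constructor
  · apply Real.sqrt_le_sqrt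
    rw [div_le_div_iff₀ (by linarith) (by linarith)]
    refine (pow_le_pow_iff_left₀ (mul_nonneg (by linarith) (by linarith)) (mul_nonneg (by linarith) (by linarith)) two_ne_zero).1 ?_
    rw [mul_pow, mul_pow, has, hbs]
    nlinarith [mul_le_mul_of_nonneg_left hlog (show (0:ℝ) ≤ s by linarith), mul_nonneg (mul_nonneg (sub_nonneg.2 hst) (show (0:ℝ) ≤ t + s by linarith)) (sub_nonneg.2 hls), mul_nonneg (sub_nonneg.2 hst) (show (0:ℝ) ≤ t by linarith)]
  · apply Real.sqrt_le_iff.2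
    refine ⟨by positivity, ?_⟩
    have hsl : √(Real.log s) ≤ s := by
      have : Real.log s ≤ s - 1 := Real.log_le_sub_one_of_pos (by linarith)
      nlinarith
    have hg : 1 ≤ √(s / √(Real.log s)) := by
      apply Real.one_le_sqrt.2
      rw [le_div_iff₀ (by linarith)]; linarith
    have hg2 : √(s / √(Real.log s)) ^ 2 = s / √(Real.log s) := Real.sq_sqrt (by positivity)
    have h1 : t / √(Real.log t) ≤ t / √(Real.log s) := by
      apply div_le_div_of_nonneg_left <;> linarith
    have h2 : t / √(Real.log s) ≤ s / √(Real.log s) + 2 * k := by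
      rw [div_add' _ _ _ (by linarith)]
      apply div_le_div_of_nonneg_right _ (by linarith)
      nlinarith
    nlinarith

lemma g_close {s t : ℝ} {k : ℝ} (hk : 1 ≤ k) (hs : 3 ≤ s) (ht : 3 ≤ t) (h : |s - t| ≤ 2 * k) :
    |√(s / √(Real.log s)) - √(t / √(Real.log t))| ≤ k := by
  rw [abs_le] at h ⊢
  rcases le_total s t with h1 | h1
  · have := g_aux hk hs h1 (by linarith)
    constructor <;> linarith
  · have := g_aux hk ht h1 (by linarith)
    constructor <;> linarith

lemma g_large {t M : ℝ} (hM : 0 < M) (ht : 3 ≤ t) (h : Real.log t / t ≤ 1 / M ^ 2) :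
    M ≤ √(t / √(Real.log t)) := by
  have hls : 1 ≤ Real.log t := by
    rw [Real.le_log_iff_exp_le (by linarith)]
    have := Real.exp_one_lt_d9
    linarith
  apply Real.le_sqrt_of_sq_le
  have ha : 1 ≤ √(Real.log t) := Real.one_le_sqrt.2 hls
  have has : √(Real.log t) ^ 2 = Real.log t := Real.sq_sqrt (by linarith)
  rw [div_le_div_iff₀ (by linarith) (by positivity)] at h
  rw [le_div_iff₀ (by linarith)]
  have : √(Real.log t) ≤ Real.log t := by nlinarith
  nlinarith [mul_le_mul_of_nonneg_left this (sq_nonneg M)]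

lemma mem_sphere_succ {V : Type} {G : SimpleGraph V} {x y v : V} {ℓ : ℕ}
    (hy : y ∈ sphere G x ℓ) (hv : G.Adj y v) (hb : v ∉ ball G x ℓ) :
    v ∈ sphere G x (ℓ + 1) := by
  simp only [sphere, ball, Set.mem_ofPred_eq, not_le] at *
  have h1 : G.edist x v ≤ G.edist x y + G.edist y v := G.edist_triangle
  rw [hy, SimpleGraph.edist_eq_one_iff_adj.2 hv] at h1
  apply le_antisymm
  · exact_mod_cast h1
  · push_cast
    exact Order.add_one_le_of_lt hb

lemma nbr_bound {V : Type} [Finite V] {G : SimpleGraph V} {K : ℕ} {x y : V} {D : Set V} {ℓ : ℕ}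
    (h2 : P2 K G) (h3 : P3At K G x D) (hℓ : 1 ≤ ℓ) (hy : y ∈ sphere G x ℓ \ D) (A : Set V) :
    (G.neighborSet y ∩ A).ncard ≤
      (G.neighborSet y ∩ ((sphere G x (ℓ + 1) \ D) ∩ A)).ncard + 2 * (K * ℓ) := by
  have a1 := h2 x ℓ hℓ y hy.1
  have a2 := (h3.2 ℓ hℓ).2.1 y hy
  have hsub : G.neighborSet y ∩ A ⊆ (G.neighborSet y ∩ ((sphere G x (ℓ + 1) \ D) ∩ A)) ∪
      ((G.neighborSet y ∩ ball G x ℓ) ∪ (D ∩ G.neighborSet y)) := by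
    rintro v ⟨hv, hA⟩
    by_cases hb : v ∈ ball G x ℓ
    · exact Or.inr (Or.inl ⟨hv, hb⟩)
    by_cases hD : v ∈ D
    · exact Or.inr (Or.inr ⟨hD, hv⟩)
    exact Or.inl ⟨hv, ⟨mem_sphere_succ hy.1 hv hb, hD⟩, hA⟩
  have b1 := Set.ncard_le_ncard hsub (Set.toFinite _)
  have b2 := Set.ncard_union_le (G.neighborSet y ∩ ((sphere G x (ℓ + 1) \ D) ∩ A))
    ((G.neighborSet y ∩ ball G x ℓ) ∪ (D ∩ G.neighborSet y))
  have b3 := Set.ncard_union_le (G.neighborSet y ∩ ball G x ℓ) (D ∩ G.neighborSet y)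
  omega

open Classical in
lemma eBetween_sum {V : Type} [Fintype V] (G : SimpleGraph V) (U W : Set V) :
    eBetween G U W = ∑ u ∈ (Set.toFinite U).toFinset, (G.neighborSet u ∩ W).ncard := by
  unfold eBetween
  rw [Set.ncard_eq_toFinset_card',
    Finset.card_eq_sum_card_fiberwise (f := Prod.fst) (t := (Set.toFinite U).toFinset)]
  · refine Finset.sum_congr rfl fun u hu => ?_
    rw [Set.ncard_eq_toFinset_card']
    refine Finset.card_bij' (i := fun e _ => e.2) (j := fun v _ => (u, v)) ?_ ?_ ?_ ?_
    · rintro ⟨a, b⟩ h; simp at h ⊢; obtain ⟨⟨_, h1, h2⟩, rfl⟩ := h; exact ⟨h2, h1⟩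
    · intro v h; simp at h hu ⊢; exact ⟨hu, h.2, h.1⟩
    · rintro ⟨a, b⟩ h; simp at h ⊢; exact h.2.symm
    · intro v h; rfl
  · rintro ⟨a, b⟩ h; simp at h ⊢; exact h.1

lemma eBetween_symm {V : Type} (G : SimpleGraph V) (U W : Set V) :
    eBetween G U W = eBetween G W U := by
  unfold eBetween
  rw [← Set.ncard_image_of_injective _ Prod.swap_injective]
  congr 1
  ext ⟨a, b⟩
  simp [G.adj_comm a b]
  tauto

lemma diff_bound {V : Type} [Finite V] (N A B : Set V) :
    (N ∩ A).ncard ≤ (N ∩ B).ncard + (N ∩ (A \ B)).ncard := by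
  refine (Set.ncard_le_ncard ?_ (Set.toFinite _)).trans (Set.ncard_union_le _ _)
  rintro v ⟨h1, h2⟩
  by_cases h : v ∈ B
  · exact Or.inl ⟨h1, h⟩
  · exact Or.inr ⟨h1, h2, h⟩

/-- existence of a witness for infection in round three of `Boot₂(γ)`. -/
theorem statement12 (K : ℕ) (c : ℝ) (hc : 1 / 2 < c) :
    ∃ D₀ : ℕ, ∀ (V : Type) [Finite V], ∀ G : SimpleGraph V,
      InH K G → D₀ ≤ minDeg G → ∀ x : V, ∀ D : Set V, P3At K G x D →
      ∀ A0 : Set V, x ∈ hatIter G A0 3 \ hatIter G A0 2 →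
      ∃ W₁ W₂ : Set V,
        W₁ ⊆ sphere G x 1 \ D ∧
        W₂ ⊆ sphere G x 2 \ D ∧
        W₂ ⊆ ⋃ w ∈ W₁, G.neighborSet w ∧
        gamma' G x - 3 * K ≤ (W₁.ncard : ℝ) ∧
        (gamma' G x - 3 * K) ^ 2 / (2 * K) ≤ (W₂.ncard : ℝ) ∧
        (1 / 2 - c * Real.sqrt (Real.log (deg G x) / (deg G x))) *
              (eBetween G W₂ (sphere G x 3 \ D) : ℝ)
            + (c * Real.sqrt ((deg G x : ℝ) * Real.log (deg G x)) - 3 * gamma' G x) *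
              (W₂.ncard : ℝ)
          ≤ (eBetween G W₂ ((sphere G x 3 \ D) ∩ A0) : ℝ) := by
  have hlim : Tendsto (fun n : ℕ => Real.log n / n) atTop (nhds 0) :=
    (Real.isLittleO_log_id_atTop.tendsto_div_nhds_zero).comp tendsto_natCast_atTop_atTop
  have e1 := hlim.eventually_le_const (u := 1 / (2 * c) ^ 2) (by positivity)
  have e2 := hlim.eventually_le_const (u := 1 / (20 * (K : ℝ) + 20) ^ 2) (by positivity)
  obtain ⟨D₀, hD₀⟩ := eventually_atTop.1 ((e1.and e2).and (eventually_ge_atTop 3))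
  refine ⟨D₀ + 3, ?_⟩
  intro V _ G hG hmin x D hD A0 hx
  have hdeg : ∀ v, D₀ + 3 ≤ deg G v := fun v => hmin.trans (Nat.sInf_le ⟨v, rfl⟩)
  obtain ⟨h1, h2⟩ : P1 K G ∧ P2 K G := by
    have hcard : Nat.card V ≠ 1 := by
      intro h
      have h3 := hdeg x
      have : Subsingleton V := (Nat.card_eq_one_iff_unique.1 h).1
      have : G.neighborSet x = ∅ := by
        ext v
        simp only [mem_neighborSet, Set.mem_empty_iff_false, iff_false]
        intro hv
        exact hv.ne (Subsingleton.elim _ _)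
      simp [deg] at h3
    obtain ⟨n, hn⟩ := hG
    cases n with
    | zero => exact absurd hn hcard
    | succ n =>
      rcases hn with hn | hn
      · exact absurd hn hcard
      · exact ⟨hn.1, hn.2.1⟩
  have hsph : ∀ v, v ∈ sphere G x 1 ↔ G.Adj x v := by
    intro v
    simp [sphere, SimpleGraph.edist_eq_one_iff_adj]
  have hK : 1 ≤ K := by
    by_contra hK
    have hK : K = 0 := by omega
    have h3 := hdeg x
    have : (G.neighborSet x).Nonempty := by
      apply (Set.ncard_pos (Set.toFinite _)).1
      unfold deg at h3; omega
    obtain ⟨v, hv⟩ := this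
    have h4 := h2 x 1 le_rfl v ((hsph v).2 hv)
    have : 0 < (G.neighborSet v ∩ ball G x 1).ncard := by
      apply (Set.ncard_pos (Set.toFinite _)).2
      exact ⟨x, hv.symm, by simp [ball]⟩
    simp [hK] at h4
    omega
  have hK' : (1 : ℝ) ≤ K := by exact_mod_cast hK
  have hdx := hD₀ (deg G x) (by have := hdeg x; omega)
  obtain ⟨⟨he1, he2⟩, -⟩ := hdx
  have hdeg3 : ∀ v, (3 : ℝ) ≤ deg G v := fun v => by
    have := hdeg v
    have : 3 ≤ deg G v := by omega
    exact_mod_cast this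
  have hγ : 20 * (K : ℝ) + 20 ≤ gamma' G x := g_large (by positivity) (hdeg3 x) he2
  -- closeness of degrees and of gamma on the first two spheres
  have hclose : ∀ ℓ : ℕ, 1 ≤ ℓ → ℓ ≤ 2 → ∀ y ∈ sphere G x ℓ,
      |(deg G x : ℝ) - deg G y| ≤ 2 * K ∧ |gamma' G x - gamma' G y| ≤ K := by
    intro ℓ hl1 hl2 y hy
    have a1 : |(deg G x : ℝ) - deg G y| ≤ K * ℓ := by exact_mod_cast h1 x ℓ hl1 y hy
    have a2 : (ℓ : ℝ) ≤ 2 := by exact_mod_cast hl2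
    have a3 : |(deg G x : ℝ) - deg G y| ≤ 2 * K := by nlinarith
    exact ⟨a3, g_close hK' (hdeg3 x) (hdeg3 y) a3⟩
  set γ := gamma' G x with hγdef
  set d : ℝ := (deg G x : ℝ) with hd
  set I1 := hatIter G A0 1 with hI1
  set I2 := hatIter G A0 2 with hI2
  set W₁ : Set V := (sphere G x 1 \ D) ∩ (I2 \ I1) with hW1
  set W₂ : Set V := {y | y ∈ sphere G x 2 \ D ∧ y ∈ I1 \ A0 ∧ ∃ w ∈ W₁, G.Adj w y} with hW2
  -- size of W₁
  have hW1card : γ - 3 * K ≤ (W₁.ncard : ℝ) := by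
    have b1 : d / 2 ≤ ((G.neighborSet x ∩ I2).ncard : ℝ) := by
      have := hx.1
      rcases this with h | h
      · exact absurd h hx.2
      · simpa using h
    have b2 : ((G.neighborSet x ∩ I1).ncard : ℝ) < d / 2 - γ := by
      by_contra hcon
      push Not at hcon
      apply hx.2
      right
      simpa using hcon
    have b3 := diff_bound (G.neighborSet x) I2 I1
    have b4 : (G.neighborSet x ∩ (I2 \ I1)).ncard ≤ W₁.ncard + 1 := by
      have hsub : G.neighborSet x ∩ (I2 \ I1) ⊆ W₁ ∪ (D ∩ sphere G x 1) := by
        rintro v ⟨hv, hA⟩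
        have hv' := (hsph v).2 hv
        by_cases hDv : v ∈ D
        · exact Or.inr ⟨hDv, hv'⟩
        · exact Or.inl ⟨⟨hv', hDv⟩, hA⟩
      have c1 := Set.ncard_le_ncard hsub (Set.toFinite _)
      have c2 := Set.ncard_union_le W₁ (D ∩ sphere G x 1)
      have c3 := (hD.2 1 le_rfl).1
      rw [Nat.sub_self, pow_zero, pow_zero] at c3
      omega
    have b5 : ((G.neighborSet x ∩ I2).ncard : ℝ) ≤ (G.neighborSet x ∩ I1).ncard + (W₁.ncard + 1) := by
      exact_mod_cast b3.trans (by omega)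
    linarith
  -- each vertex of W₁ has many neighbours in W₂
  have hW1nbr : ∀ w ∈ W₁, γ - 3 * K ≤ ((G.neighborSet w ∩ W₂).ncard : ℝ) := by
    intro w hw
    have hg := (hclose 1 le_rfl (by norm_num) w hw.1.1).2
    have b1 : (deg G w : ℝ) / 2 - gamma' G w ≤ ((G.neighborSet w ∩ I1).ncard : ℝ) := by
      rcases hw.2.1 with h | h
      · exact absurd h hw.2.2
      · simpa using h
    have b2 : ((G.neighborSet w ∩ A0).ncard : ℝ) < (deg G w : ℝ) / 2 - 2 * gamma' G w := by
      by_contra hcon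
      push Not at hcon
      apply hw.2.2
      right
      simpa [hatIter] using hcon
    have b3 := diff_bound (G.neighborSet w) I1 A0
    have b4 := nbr_bound h2 hD le_rfl hw.1 (I1 \ A0)
    have b5 : (G.neighborSet w ∩ ((sphere G x (1 + 1) \ D) ∩ (I1 \ A0))).ncard ≤
        (G.neighborSet w ∩ W₂).ncard := by
      apply Set.ncard_le_ncard _ (Set.toFinite _)
      rintro v ⟨hv, hs, hA⟩
      exact ⟨hv, hs, hA, w, hw, hv⟩
    have b6 : ((G.neighborSet w ∩ I1).ncard : ℝ) ≤ (G.neighborSet w ∩ A0).ncard +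
        ((G.neighborSet w ∩ W₂).ncard + 2 * K) := by
      exact_mod_cast b3.trans (by omega)
    rw [abs_le] at hg
    linarith
  classical
  have := Fintype.ofFinite V
  refine ⟨W₁, W₂, Set.inter_subset_left, fun y hy => hy.1, ?_, hW1card, ?_, ?_⟩
  · intro y hy
    obtain ⟨w, hw, hwy⟩ := hy.2.2
    simp only [Set.mem_iUnion]
    exact ⟨w, hw, hwy⟩
  · rw [div_le_iff₀ (by positivity)]
    have c1 : (γ - 3 * K) * (W₁.ncard : ℝ) ≤ eBetween G W₁ W₂ := by
      rw [eBetween_sum, Set.ncard_eq_toFinset_card W₁]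
      push_cast
      rw [mul_comm, ← nsmul_eq_mul]
      apply Finset.card_nsmul_le_sum
      intro w hw
      exact hW1nbr w (by simpa using hw)
    have c2 : eBetween G W₁ W₂ ≤ W₂.ncard * (K * 2) := by
      rw [eBetween_symm, eBetween_sum, Set.ncard_eq_toFinset_card W₂, ← smul_eq_mul]
      apply Finset.sum_le_card_nsmul
      intro y hy
      have hy : y ∈ W₂ := (Set.Finite.mem_toFinset _).1 hy
      refine (Set.ncard_le_ncard ?_ (Set.toFinite _)).trans (h2 x 2 (by norm_num) y hy.1.1)
      rintro v ⟨hv, hv1⟩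
      refine ⟨hv, ?_⟩
      have : G.edist x v = 1 := by exact_mod_cast hv1.1.1
      simp only [ball, Set.mem_ofPred_eq, this]
      norm_num
    have c3 : (eBetween G W₁ W₂ : ℝ) ≤ W₂.ncard * (K * 2) := by exact_mod_cast c2
    nlinarith
  · rw [eBetween_sum, eBetween_sum, Set.ncard_eq_toFinset_card W₂]
    push_cast
    rw [Finset.mul_sum, mul_comm _ ((Set.toFinite W₂).toFinset.card : ℝ), ← nsmul_eq_mul, ← Finset.sum_const,
      ← Finset.sum_add_distrib]
    apply Finset.sum_le_sum
    intro y hy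
    have hy : y ∈ W₂ := (Set.Finite.mem_toFinset _).1 hy
    obtain ⟨hdy, hgy⟩ := hclose 2 (by norm_num) le_rfl y hy.1.1
    rw [abs_le] at hdy hgy
    have b1 : (deg G y : ℝ) / 2 - 2 * gamma' G y ≤ ((G.neighborSet y ∩ A0).ncard : ℝ) := by
      rcases hy.2.1.1 with h | h
      · exact absurd h hy.2.1.2
      · simpa [hatIter] using h
    have b2 := nbr_bound h2 hD (by norm_num) hy.1 A0
    have b3 : ((G.neighborSet y ∩ A0).ncard : ℝ) ≤
        ((G.neighborSet y ∩ ((sphere G x 3 \ D) ∩ A0)).ncard : ℝ) + 2 * (K * 2) := by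
      exact_mod_cast b2
    have b4 : ((G.neighborSet y ∩ (sphere G x 3 \ D)).ncard : ℝ) ≤ deg G y := by
      exact_mod_cast Set.ncard_le_ncard Set.inter_subset_left (Set.toFinite _)
    have hd3 : 3 ≤ d := hdeg3 x
    have b5 : √(d * Real.log d) = √(Real.log d / d) * d := by
      have : d * Real.log d = Real.log d / d * d ^ 2 := by field_simp
      rw [this, Real.sqrt_mul' _ (sq_nonneg d), Real.sqrt_sq (by linarith)]
    have b6 : c * √(Real.log d / d) ≤ 1 / 2 := by
      have : √(Real.log d / d) ≤ 1 / (2 * c) := by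
        apply Real.sqrt_le_iff.2
        refine ⟨by positivity, ?_⟩
        rw [div_pow, one_pow]
        exact he1
      calc c * √(Real.log d / d) ≤ c * (1 / (2 * c)) := by gcongr
        _ = 1 / 2 := by field_simp
    have b0 : 0 ≤ c * √(Real.log d / d) := by positivity
    rw [b5]
    set q := c * √(Real.log d / d) with hq
    have b7 : (1 / 2 - q) * ((G.neighborSet y ∩ (sphere G x 3 \ D)).ncard : ℝ) ≤
        (1 / 2 - q) * (d + 2 * K) := by
      apply mul_le_mul_of_nonneg_left _ (by linarith)
      linarith
    have b8 : c * (√(Real.log d / d) * d) = q * d := by rw [hq]; ring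
    rw [b8]
    nlinarith [mul_nonneg b0 (show (0:ℝ) ≤ K by positivity)]


end MBP
end

section
/- For every K ∈ ℕ and all constants c > 1/2, 0 < b₁ ≤ b₂ and ε > 0 there exists D₀ such that the following holds. Let G ∈ H(K) be a finite graph with δ(G) ≥ D₀, let x ∈ V(G), write d := d(x) and γ := √(d/√(log d)), let p := 1/2 − c·√(log d/d), let D be a set witnessing property (P3) for x with S₀(x,ℓ) := S(x,ℓ)\D, and let W₂ ⊆ S₀(x,2) be any set whose size s := |W₂| satisfies b₁·γ² ≤ s ≤ b₂·γ². Let A₀ be a p-random subset of V(G) and set Z := e(W₂, S₀(x,3) ∩ A₀). Then Pr[ Z ≥ p·e(W₂, S₀(x,3)) + (c·√(d·log d) − 3γ)·s ] ≤ exp(−(2−ε)·c²·s·log d). -/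
open SimpleGraph Filter

namespace MBP

open MeasureTheory ProbabilityTheory in
lemma bern_mgf (p u : ℝ) (h0 : 0 ≤ p) (h1 : p ≤ 1) :
    (1 - p) + p * Real.exp u ≤ Real.exp (p * u + u ^ 2 / 8) := by
  let μ : Measure ℝ := ENNReal.ofReal (1 - p) • Measure.dirac 0 + ENNReal.ofReal p • Measure.dirac 1
  have hint : ∀ f : ℝ → ℝ, ∫ x, f x ∂μ = (1 - p) * f 0 + p * f 1 := by
    intro f
    rw [integral_add_measure]
    · simp [integral_smul_measure, ENNReal.toReal_ofReal, h0, sub_nonneg.2 h1]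
    · exact (integrable_dirac (by simp)).smul_measure (by simp)
    · exact (integrable_dirac (by simp)).smul_measure (by simp)
  haveI : IsProbabilityMeasure μ := by
    constructor
    simp only [μ, Measure.add_apply, Measure.smul_apply, measure_univ, smul_eq_mul, mul_one]
    rw [← ENNReal.ofReal_add (by linarith) h0]
    simp
  have hb : ∀ᵐ x ∂μ, (id x : ℝ) ∈ Set.Icc (0 : ℝ) 1 := by
    simp only [μ, ae_add_measure_iff]
    constructor
    · apply Measure.ae_smul_measure
      simp [ae_dirac_eq]
    · apply Measure.ae_smul_measure
      simp [ae_dirac_eq]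
  have h := (hasSubgaussianMGF_of_mem_Icc (μ := μ) aemeasurable_id hb).mgf_le u
  simp only [mgf, hint] at h
  simp only [id] at h
  have e : Real.exp (p * u + u ^ 2 / 8) = Real.exp (p * u) * Real.exp (u ^ 2 / 8) := Real.exp_add _ _
  rw [e]
  have e2 : (1 - p) + p * Real.exp u = Real.exp (p * u) *
      ((1 - p) * Real.exp (u * (0 - ((1 - p) * 0 + p * 1))) +
        p * Real.exp (u * (1 - ((1 - p) * 0 + p * 1)))) := by
    have a1 : Real.exp (p * u) * Real.exp (u * (0 - ((1 - p) * 0 + p * 1))) = 1 := by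
      rw [← Real.exp_add, show p * u + u * (0 - ((1 - p) * 0 + p * 1)) = 0 by ring, Real.exp_zero]
    have a2 : Real.exp (p * u) * Real.exp (u * (1 - ((1 - p) * 0 + p * 1))) = Real.exp u := by
      rw [← Real.exp_add]; congr 1; ring
    linear_combination (-(1 - p)) * a1 - p * a2
  rw [e2]
  refine mul_le_mul_of_nonneg_left (h.trans (le_of_eq ?_)) (Real.exp_pos _).le
  congr 1
  simp
  ring

open Classical in
lemma prob_eq_sum {V : Type} [Fintype V] (p : ℝ) (E : Set V → Prop) :
    prob p E = ∑ A : Finset V, if E (A : Set V) then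
      p ^ A.card * (1 - p) ^ (Finset.univ \ A).card else 0 := by
  unfold prob
  rw [finsum_mem_def, finsum_eq_sum_of_fintype, ← Equiv.sum_comp Fintype.finsetEquivSet]
  refine Finset.sum_congr rfl fun A _ => ?_
  have hc : ((A : Set V)ᶜ).ncard = (Finset.univ \ A).card := by
    rw [← Set.ncard_coe_finset]; congr 1; ext; simp
  simp only [Set.indicator, Set.mem_ofPred_eq, Fintype.finsetEquivSet_apply, weight, hc,
    Set.ncard_coe_finset]

open Classical in
lemma chernoff {V : Type} [Fintype V] (p : ℝ) (h0 : 0 ≤ p) (h1 : p ≤ 1) (a : V → ℝ)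
    (t Q r : ℝ) (hr : 0 ≤ r) (hQ : ∑ v, a v ^ 2 ≤ Q) (E : Set V → Prop)
    (hE : ∀ A : Finset V, E (A : Set V) → p * ∑ v, a v + t ≤ ∑ v ∈ A, a v) :
    prob p E ≤ Real.exp (-(r * t) + r ^ 2 * Q / 8) := by
  rw [prob_eq_sum]
  have key : ∑ A : Finset V, (∏ v ∈ A, (p * Real.exp (r * a v))) *
      ∏ v ∈ Finset.univ \ A, (1 - p) ≤ Real.exp (r * (p * ∑ v, a v) + r ^ 2 * Q / 8) := by
    have := Finset.prod_add (fun v => p * Real.exp (r * a v)) (fun _ => 1 - p) (Finset.univ : Finset V)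
    rw [Finset.powerset_univ] at this
    rw [← this]
    calc ∏ v, (p * Real.exp (r * a v) + (1 - p))
        ≤ ∏ v, Real.exp (p * (r * a v) + (r * a v) ^ 2 / 8) := by
          refine Finset.prod_le_prod (fun v _ => ?_) (fun v _ => ?_)
          · have := Real.exp_pos (r * a v)
            have := mul_nonneg h0 this.le
            linarith
          · rw [add_comm]; exact bern_mgf p _ h0 h1
      _ = Real.exp (r * (p * ∑ v, a v) + r ^ 2 * (∑ v, a v ^ 2) / 8) := by
          rw [← Real.exp_sum]; congr 1
          rw [Finset.sum_add_distrib]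
          simp only [Finset.mul_sum, Finset.sum_div]
          congr 1 <;> refine Finset.sum_congr rfl fun v _ => by ring
      _ ≤ _ := by
          apply Real.exp_le_exp.2
          have := mul_le_mul_of_nonneg_left hQ (sq_nonneg r)
          linarith
  calc _ ≤ ∑ A : Finset V, Real.exp (-(r * (p * ∑ v, a v + t))) *
        ((∏ v ∈ A, (p * Real.exp (r * a v))) * ∏ v ∈ Finset.univ \ A, (1 - p)) := by
        refine Finset.sum_le_sum fun A _ => ?_
        rw [Finset.prod_mul_distrib, Finset.prod_const, Finset.prod_const, ← Real.exp_sum]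
        have hw : 0 ≤ p ^ A.card * (1 - p) ^ (Finset.univ \ A).card :=
          mul_nonneg (pow_nonneg h0 _) (pow_nonneg (by linarith) _)
        have e : Real.exp (-(r * (p * ∑ v, a v + t))) * ((p ^ A.card * Real.exp (∑ v ∈ A, r * a v)) *
            (1 - p) ^ (Finset.univ \ A).card) = (p ^ A.card * (1 - p) ^ (Finset.univ \ A).card) *
            Real.exp (r * (∑ v ∈ A, a v - (p * ∑ v, a v + t))) := by
          have : Real.exp (r * (∑ v ∈ A, a v - (p * ∑ v, a v + t))) =
            Real.exp (-(r * (p * ∑ v, a v + t))) * Real.exp (∑ v ∈ A, r * a v) := by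
            rw [← Real.exp_add, ← Finset.mul_sum]; congr 1; ring
          rw [this]; ring
        rw [e]
        split_ifs with h
        · have := hE A h
          exact le_mul_of_one_le_right hw (Real.one_le_exp (mul_nonneg hr (by linarith)))
        · exact mul_nonneg hw (Real.exp_pos _).le
    _ ≤ Real.exp (-(r * (p * ∑ v, a v + t))) * Real.exp (r * (p * ∑ v, a v) + r ^ 2 * Q / 8) := by
        rw [← Finset.mul_sum]
        exact mul_le_mul_of_nonneg_left key (Real.exp_pos _).le
    _ = _ := by
        rw [← Real.exp_add]; congr 1; ring

open Classical in
/-- Number of neighbours of `v` in `U`, if `v ∈ S`, and `0` otherwise. -/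
noncomputable def cnt {V : Type} [Fintype V] (G : SimpleGraph V) (U S : Set V) (v : V) : ℝ :=
  ∑ w ∈ U.toFinset, if v ∈ S ∧ G.Adj w v then (1:ℝ) else 0

open Classical in
lemma eBetween_eq {V : Type} [Fintype V] (G : SimpleGraph V) (U : Set V) (S : Set V)
    (A : Finset V) :
    (eBetween G U (S ∩ A) : ℝ) = ∑ v ∈ A, cnt G U S v := by
  unfold cnt
  have : {e : V × V | e.1 ∈ U ∧ e.2 ∈ S ∩ (A : Set V) ∧ G.Adj e.1 e.2} =
    (((U.toFinset ×ˢ A).filter fun e => e.2 ∈ S ∧ G.Adj e.1 e.2 : Finset (V × V)) : Set (V × V)) := by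
    ext e; simp; tauto
  rw [eBetween, this, Set.ncard_coe_finset, Finset.card_filter, Finset.sum_product]
  push_cast
  rw [Finset.sum_comm]

open Classical in
lemma sum_sq_le {V : Type} [Fintype V] (G : SimpleGraph V) (U S : Set V) (m : ℝ)
    (hdeg : ∀ w ∈ U, (deg G w : ℝ) ≤ m)
    (h3 : ∀ y ∈ U, ∀ z ∈ U, y ≠ z → (G.neighborSet y ∩ G.neighborSet z ∩ S).ncard ≤ 1) :
    ∑ v, cnt G U S v ^ 2 ≤ U.ncard * (m + U.ncard) := by
  unfold cnt
  have hU : U.ncard = U.toFinset.card := Set.ncard_eq_toFinset_card' U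
  have hcard : ∀ y z : V, (∑ v, (if v ∈ S ∧ G.Adj y v then (1:ℝ) else 0) *
      (if v ∈ S ∧ G.Adj z v then (1:ℝ) else 0)) =
      ((G.neighborSet y ∩ G.neighborSet z ∩ S).ncard : ℝ) := by
    intro y z
    have : (G.neighborSet y ∩ G.neighborSet z ∩ S) =
      ((Finset.univ.filter fun v => (v ∈ S ∧ G.Adj y v) ∧ (v ∈ S ∧ G.Adj z v) : Finset V) : Set V) := by
      ext v; simp; tauto
    rw [this, Set.ncard_coe_finset, Finset.card_filter]
    push_cast
    refine Finset.sum_congr rfl fun v _ => ?_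
    by_cases h1 : v ∈ S ∧ G.Adj y v <;> by_cases h2 : v ∈ S ∧ G.Adj z v <;> simp only [h1, h2] <;> simp
  calc _ = ∑ y ∈ U.toFinset, ∑ z ∈ U.toFinset, ((G.neighborSet y ∩ G.neighborSet z ∩ S).ncard : ℝ) := by
        simp only [sq, Finset.sum_mul_sum, ← hcard]
        rw [Finset.sum_comm]
        refine Finset.sum_congr rfl fun y _ => ?_
        rw [Finset.sum_comm]
    _ ≤ ∑ y ∈ U.toFinset, ∑ z ∈ U.toFinset, ((if y = z then m else 0) + 1) := by
        refine Finset.sum_le_sum fun y hy => Finset.sum_le_sum fun z hz => ?_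
        rw [Set.mem_toFinset] at hy hz
        split_ifs with h
        · subst h
          have : (G.neighborSet y ∩ G.neighborSet y ∩ S).ncard ≤ deg G y :=
            Set.ncard_le_ncard (fun v hv => hv.1.1) (Set.toFinite _)
          have h' : ((G.neighborSet y ∩ G.neighborSet y ∩ S).ncard : ℝ) ≤ deg G y := by exact_mod_cast this
          linarith [hdeg y hy]
        · simpa using h3 y hy z hz h
    _ = _ := by
        rw [hU]
        simp only [Finset.sum_add_distrib, Finset.sum_ite_eq, Finset.sum_const, nsmul_eq_mul, mul_one]
        rw [Finset.sum_congr rfl (fun y hy => if_pos hy)]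
        simp
        ring

lemma asymp (K : ℕ) (c b ε : ℝ) (hc : 1 / 2 < c) (hε : 0 < ε) :
    ∀ᶠ d : ℕ in atTop, 1 ≤ Real.log d ∧ 1 ≤ d ∧
      c * Real.sqrt (Real.log d / d) ≤ 1 / 2 ∧
      0 ≤ c - 3 * (1 / (Real.sqrt (Real.log d) * Real.sqrt (Real.sqrt (Real.log d)))) ∧
      (2 - ε) * c ^ 2 * (1 + 2 * K / d + b / Real.sqrt (Real.log d)) ≤
        2 * (c - 3 * (1 / (Real.sqrt (Real.log d) * Real.sqrt (Real.sqrt (Real.log d))))) ^ 2 := by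
  have hcast : Tendsto (fun d : ℕ => (d : ℝ)) atTop atTop := tendsto_natCast_atTop_atTop
  have hL : Tendsto (fun d : ℕ => Real.log d) atTop atTop := Real.tendsto_log_atTop.comp hcast
  have hsL : Tendsto (fun d : ℕ => Real.sqrt (Real.log d)) atTop atTop := Real.tendsto_sqrt_atTop.comp hL
  have hssL := Real.tendsto_sqrt_atTop.comp hsL
  have hη : Tendsto (fun d : ℕ => 1 / (Real.sqrt (Real.log d) * Real.sqrt (Real.sqrt (Real.log d))))
      atTop (nhds 0) := by
    simp only [one_div]
    exact (hsL.atTop_mul_atTop₀ hssL).inv_tendsto_atTop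
  have hσ : Tendsto (fun d : ℕ => c * Real.sqrt (Real.log d / d)) atTop (nhds 0) := by
    have h1 : Tendsto (fun d : ℕ => Real.log d / d) atTop (nhds 0) := by
      have := (Real.isLittleO_log_id_atTop.tendsto_div_nhds_zero).comp hcast
      exact this
    have h2 := (Real.continuous_sqrt.tendsto 0).comp h1
    have h3 := h2.const_mul c
    simpa using h3
  have hf : Tendsto (fun d : ℕ => c - 3 * (1 / (Real.sqrt (Real.log d) * Real.sqrt (Real.sqrt (Real.log d)))))
      atTop (nhds c) := by
    simpa using (hη.const_mul 3).const_sub c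
  have hR := (hf.pow 2).const_mul 2
  have hK : Tendsto (fun d : ℕ => 2 * (K:ℝ) / d) atTop (nhds 0) := hcast.const_div_atTop _
  have hB : Tendsto (fun d : ℕ => b / Real.sqrt (Real.log d)) atTop (nhds 0) := hsL.const_div_atTop _
  have hl := ((hK.const_add 1).add hB).const_mul ((2 - ε) * c ^ 2)
  have hlt : (2 - ε) * c ^ 2 * (1 + 0 + 0) < 2 * c ^ 2 := by
    have : 0 < c ^ 2 := by positivity
    nlinarith
  filter_upwards [hL.eventually_ge_atTop 1, eventually_ge_atTop 1, hσ.eventually_le_const (show (0:ℝ) < 1/2 by norm_num),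
    hf.eventually_const_le (show 0 < c by linarith), hl.eventually_lt hR hlt] with d h1 h2 h3 h4 h5
  exact ⟨h1, h2, h3, h4, h5.le⟩

lemma minDeg_le {V : Type} (G : SimpleGraph V) (x : V) : minDeg G ≤ deg G x :=
  Nat.sInf_le ⟨x, rfl⟩

lemma InH.P1 {K : ℕ} {V : Type} [Finite V] {G : SimpleGraph V} (h : InH K G) (x : V) (hd : 1 ≤ minDeg G) :
    P1 K G := by
  have h1 : Nat.card V ≠ 1 := by
    intro h1
    have := (Nat.card_eq_one_iff_unique.1 h1).1
    have h2 : deg G x = 0 := by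
      unfold deg
      rw [Set.ncard_eq_zero (Set.toFinite _)]
      ext y
      simp only [mem_neighborSet, Set.mem_empty_iff_false, iff_false]
      intro hxy
      exact hxy.ne (Subsingleton.elim _ _)
    have := minDeg_le G x
    omega
  obtain ⟨n, hn⟩ := h
  cases n with
  | zero => exact absurd hn h1
  | succ n => exact (hn.resolve_left h1).1

/-- probability that the edge count into the initially infected set is large. -/
theorem statement13 (K : ℕ) (c b₁ b₂ ε : ℝ) (hc : 1 / 2 < c) (hb₁ : 0 < b₁)
    (hb : b₁ ≤ b₂) (hε : 0 < ε) :
    ∃ D₀ : ℕ, ∀ (V : Type) [Finite V], ∀ G : SimpleGraph V,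
      InH K G → D₀ ≤ minDeg G → ∀ x : V, ∀ D : Set V, P3At K G x D →
      ∀ W₂ : Set V, W₂ ⊆ sphere G x 2 \ D →
      b₁ * gamma' G x ^ 2 ≤ (W₂.ncard : ℝ) → (W₂.ncard : ℝ) ≤ b₂ * gamma' G x ^ 2 →
      prob (1 / 2 - c * Real.sqrt (Real.log (deg G x) / (deg G x)))
          (fun A0 =>
            (1 / 2 - c * Real.sqrt (Real.log (deg G x) / (deg G x))) *
                  (eBetween G W₂ (sphere G x 3 \ D) : ℝ)
                + (c * Real.sqrt ((deg G x : ℝ) * Real.log (deg G x)) - 3 * gamma' G x) *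
                  (W₂.ncard : ℝ)
              ≤ (eBetween G W₂ ((sphere G x 3 \ D) ∩ A0) : ℝ))
        ≤ Real.exp (-((2 - ε) * c ^ 2 * (W₂.ncard : ℝ) * Real.log (deg G x))) := by
  classical
  obtain ⟨D₀, hD₀⟩ := eventually_atTop.1 (asymp K c b₂ ε hc hε)
  refine ⟨max D₀ 1, ?_⟩
  intro V _ G hG hmin x D hD W hW hs1 hs2
  haveI := Fintype.ofFinite V
  have hx := minDeg_le G x
  obtain ⟨hL1, hd1, hp, hf0, hmain⟩ := hD₀ (deg G x) (by omega)
  have hP1 := hG.P1 x (by omega)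
  set S := sphere G x 3 \ D with hS
  have hd0 : (1:ℝ) ≤ deg G x := by exact_mod_cast hd1
  have hdeg : ∀ w ∈ W, (deg G w : ℝ) ≤ deg G x + 2 * K := by
    intro w hw
    have h := hP1 x 2 (by norm_num) w (hW hw).1
    have h2 := (abs_le.1 h).1
    have : (deg G w : ℤ) ≤ deg G x + 2 * K := by push_cast at h2; linarith
    exact_mod_cast this
  have hsq := sum_sq_le G W S _ hdeg (fun y hy z hz hyz => (hD.2 2 (by norm_num)).2.2.1 y (hW hy) z (hW hz) hyz)
  have heU : (eBetween G W S : ℝ) = ∑ v, cnt G W S v := by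
    rw [← eBetween_eq]; simp
  rw [heU]
  set a : V → ℝ := cnt G W S with ha
  set d : ℝ := (deg G x : ℝ) with hd
  set L := Real.log d with hLdef
  set s : ℝ := (W.ncard : ℝ) with hs
  set η := 1 / (Real.sqrt L * Real.sqrt (Real.sqrt L)) with hη
  set q := 1 + 2 * (K:ℝ) / d + b₂ / Real.sqrt L with hq
  have hsL : 0 < Real.sqrt L := Real.sqrt_pos.2 (by linarith)
  have hssL : 0 < Real.sqrt (Real.sqrt L) := Real.sqrt_pos.2 hsL
  have hb2 : 0 < b₂ := by linarith
  have hγ2 : gamma' G x ^ 2 = d / Real.sqrt L := by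
    unfold gamma'; rw [Real.sq_sqrt]; positivity
  have hγ : gamma' G x = Real.sqrt (d * L) * η := by
    unfold gamma'
    rw [Real.sqrt_div (by linarith), Real.sqrt_mul (by linarith), hη]
    change Real.sqrt d / Real.sqrt (Real.sqrt L) = _
    field_simp
  have hspos : 0 < s := by
    refine lt_of_lt_of_le ?_ hs1
    rw [hγ2]; positivity
  have hqpos : 0 < q := by positivity
  have hQ : ∑ v, a v ^ 2 ≤ s * d * q := by
    refine hsq.trans ?_
    rw [mul_assoc]
    apply mul_le_mul_of_nonneg_left _ hspos.le
    rw [hγ2] at hs2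
    have : d * q = d + 2 * K + b₂ * (d / Real.sqrt L) := by
      rw [hq]; field_simp
    rw [this]; linarith
  have ht0 : 0 ≤ Real.sqrt (d * L) * (c - 3 * η) := mul_nonneg (Real.sqrt_nonneg _) hf0
  have hch := chernoff (1 / 2 - c * Real.sqrt (L / d)) (by linarith)
    (by have : 0 ≤ c * Real.sqrt (L / d) := mul_nonneg (by linarith) (Real.sqrt_nonneg _)
        linarith) a ((c * Real.sqrt (d * L) - 3 * gamma' G x) * s) (s * d * q)
    (4 * (Real.sqrt (d * L) * (c - 3 * η)) / (d * q)) (by positivity) hQ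
    (fun A0 => (1 / 2 - c * Real.sqrt (L / d)) * ∑ v, a v +
      (c * Real.sqrt (d * L) - 3 * gamma' G x) * s ≤ (eBetween G W (S ∩ A0) : ℝ))
    (by
      intro A hA
      rw [eBetween_eq] at hA
      exact hA)
  refine hch.trans (Real.exp_le_exp.2 ?_)
  have e1 : c * Real.sqrt (d * L) - 3 * gamma' G x = Real.sqrt (d * L) * (c - 3 * η) := by
    rw [hγ]; ring
  rw [e1]
  have hsqr : Real.sqrt (d * L) ^ 2 = d * L := Real.sq_sqrt (by positivity)
  have e2 : -(4 * (Real.sqrt (d * L) * (c - 3 * η)) / (d * q) * (Real.sqrt (d * L) * (c - 3 * η) * s)) +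
      (4 * (Real.sqrt (d * L) * (c - 3 * η)) / (d * q)) ^ 2 * (s * d * q) / 8 =
      -(s * L * (2 * (c - 3 * η) ^ 2 / q)) := by
    have : ∀ T : ℝ, -(4 * T / (d * q) * (T * s)) + (4 * T / (d * q)) ^ 2 * (s * d * q) / 8 =
        -(2 * T ^ 2 * s / (d * q)) := by
      intro T; field_simp; ring
    rw [this, mul_pow, hsqr]
    field_simp
  rw [e2]
  have h6 : (2 - ε) * c ^ 2 ≤ 2 * (c - 3 * η) ^ 2 / q := (le_div_iff₀ hqpos).2 hmain
  have h7 : 0 ≤ s * L := by positivity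
  have := mul_le_mul_of_nonneg_left h6 h7
  linarith

end MBP
end
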